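/- arXiv:2012.09205 — 5 statements merged into one kernel-verified Lean document; each statement's English description precedes it below -/
import Mathlib

section
/- Let c ∈ (0,1) and let φ : ℝ → ℂ be a Schwartz function. Then ∫_{−∞}^0 (−x)^{−c} (𝓕φ)(x) dx = Γ(1−c) · (2π)^{c−1} · ∫_ℝ |ξ|^{c−1} ( sin(πc/2) + i · sgn(ξ) · cos(πc/2) ) φ(ξ) dξ, where both integrals converge absolutely. Equivalently, the tempered distribution h_c(x) = |x|^{−c} 1_{(−∞,0)}(x) has Fourier transform Γ(1−c)(2π)^{c−1}|ξ|^{c−1}( sin(πc/2) + i·sgn(ξ)·cos(πc/2) ). -/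
open MeasureTheory Real Complex
open scoped FourierTransform

/-- A bounded continuous integrable function stays integrable on `(0, ∞)` after multiplication by
the locally integrable power `t ^ s`, `-1 < s ≤ 0`. -/
lemma integrableOn_Ioi_rpow_mul {s : ℝ} (hs : -1 < s) (hs' : s ≤ 0) {g : ℝ → ℂ}
    (hg : Integrable g) (hgc : Continuous g) {C : ℝ} (hC : ∀ x, ‖g x‖ ≤ C) :
    IntegrableOn (fun t : ℝ => ((t ^ s : ℝ) : ℂ) * g t) (Set.Ioi 0) := by
  rw [← Set.Ioc_union_Ioi_eq_Ioi zero_le_one]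
  refine IntegrableOn.union ?_ ?_
  · have h : IntegrableOn (fun t : ℝ => ((t ^ s : ℝ) : ℂ)) (Set.Ioc 0 1) :=
      (intervalIntegral.intervalIntegrable_rpow' (a := 0) (b := 1) hs).1.ofReal
    exact Integrable.mul_bdd (c := C) h hgc.aestronglyMeasurable (.of_forall hC)
  · refine hg.integrableOn.bdd_mul (c := 1) (by fun_prop) ?_
    filter_upwards [ae_restrict_mem measurableSet_Ioi] with t ht
    have ht' : (1 : ℝ) < t := ht
    rw [Complex.norm_real, Real.norm_of_nonneg (by positivity)]
    exact Real.rpow_le_one_of_one_le_of_nonpos ht'.le hs'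

lemma integrableOn_rpow_mul_cexp_neg_mul {a : ℝ} (ha : 0 < a) {r : ℂ} (hr : 0 < r.re) :
    IntegrableOn (fun t : ℝ => ((t ^ (a - 1) : ℝ) : ℂ) * cexp (-(r * t))) (Set.Ioi 0) := by
  have h := integrableOn_rpow_mul_exp_neg_mul_rpow (s := a - 1) (p := 1) (by linarith) one_pos hr
  refine h.mono' (by fun_prop) ?_
  filter_upwards [ae_restrict_mem measurableSet_Ioi] with t ht
  have ht' : (0 : ℝ) < t := ht
  rw [norm_mul, Complex.norm_real, Real.norm_of_nonneg (by positivity), Complex.norm_exp]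
  simp

/-- The Laplace transform of `t ^ (a - 1)` at a complex parameter in the right half plane. -/
lemma integral_rpow_mul_cexp_neg_mul_Ioi {a : ℝ} (ha : 0 < a) {r : ℂ} (hr : 0 < r.re) :
    ∫ t : ℝ in Set.Ioi 0, ((t ^ (a - 1) : ℝ) : ℂ) * cexp (-(r * t)) =
      Real.Gamma a * r ^ (-a : ℂ) := by
  have hopen : IsOpen {z : ℂ | 0 < z.re} := isOpen_lt continuous_const Complex.continuous_re
  have hL : DifferentiableOn ℂ
      (fun z : ℂ => ∫ t : ℝ in Set.Ioi 0, ((t ^ (a - 1) : ℝ) : ℂ) * cexp (-(z * t)))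
      {z : ℂ | 0 < z.re} := by
    intro z hz
    have hz' : 0 < z.re := hz
    have hb := integrableOn_rpow_mul_exp_neg_mul_rpow (s := a) (p := 1) (b := z.re / 2)
      (by linarith) one_pos (by positivity)
    refine (hasDerivAt_integral_of_dominated_loc_of_deriv_le
      (μ := volume.restrict (Set.Ioi 0))
      (F := fun (w : ℂ) (t : ℝ) => ((t ^ (a - 1) : ℝ) : ℂ) * cexp (-(w * t)))
      (s := {w : ℂ | z.re / 2 < w.re})
      (F' := fun w t => ((t ^ (a - 1) : ℝ) : ℂ) * (cexp (-(w * t)) * -(t : ℂ)))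
      ((isOpen_lt continuous_const Complex.continuous_re).mem_nhds (half_lt_self hz'))
      (.of_forall fun w => by fun_prop) (integrableOn_rpow_mul_cexp_neg_mul ha hz')
      (by fun_prop) ?_ hb ?_).2.differentiableAt.differentiableWithinAt
    · filter_upwards [ae_restrict_mem measurableSet_Ioi] with t ht w hw
      have ht' : (0 : ℝ) < t := ht
      have hw' : z.re / 2 < w.re := hw
      rw [norm_mul, norm_mul, norm_neg, Complex.norm_real, Complex.norm_real,
        Real.norm_of_nonneg (by positivity), Real.norm_of_nonneg ht'.le, Complex.norm_exp,
        mul_comm (Real.exp _), ← mul_assoc, ← Real.rpow_add_one ht'.ne', sub_add_cancel,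
        Real.rpow_one]
      gcongr
      simp
      gcongr
    · filter_upwards with t w _
      refine HasDerivAt.const_mul _ (HasDerivAt.cexp ?_)
      simpa using! ((hasDerivAt_id w).mul_const (t : ℂ)).neg
  have hR : DifferentiableOn ℂ (fun z : ℂ => Real.Gamma a * z ^ (-a : ℂ)) {z : ℂ | 0 < z.re} :=
    fun z hz => ((differentiableAt_id.cpow_const (Or.inl hz)).const_mul _).differentiableWithinAt
  refine (hL.analyticOnNhd hopen).eqOn_of_preconnected_of_frequently_eq (hR.analyticOnNhd hopen)
    (convex_halfSpace_re_gt 0).isPreconnected (z₀ := 1) (by simp) ?_ hr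
  have hreal : ∀ x : ℝ, 0 < x →
      ∫ t : ℝ in Set.Ioi 0, ((t ^ (a - 1) : ℝ) : ℂ) * cexp (-((x : ℂ) * t)) =
        Real.Gamma a * (x : ℂ) ^ (-a : ℂ) := by
    intro x hx
    have h := Real.integral_rpow_mul_exp_neg_mul_Ioi ha hx
    have h' := congrArg (fun y : ℝ => (y : ℂ)) h
    simp only [← integral_complex_ofReal] at h'
    push_cast at h'
    rw [h', one_div, mul_comm,
      Real.inv_rpow hx.le, ← Real.rpow_neg hx.le, Complex.ofReal_cpow hx.le]
    simp
  have htend : Filter.Tendsto (fun x : ℝ => (x : ℂ)) (nhdsWithin 1 {1}ᶜ) (nhdsWithin 1 {1}ᶜ) := by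
    refine tendsto_nhdsWithin_of_tendsto_nhds_of_eventually_within _ ?_ ?_
    · exact (Complex.continuous_ofReal.tendsto' 1 1 (by simp)).mono_left nhdsWithin_le_nhds
    · filter_upwards [self_mem_nhdsWithin] with x hx
      simpa using hx
  refine htend.frequently (Filter.Eventually.frequently ?_)
  filter_upwards [nhdsWithin_le_nhds (Ioi_mem_nhds one_pos)] with x hx using hreal x hx

/-- Abel-regularised form of the Fourier transform of `|x| ^ (a - 1)` on the negative half line. -/
lemma integral_rpow_mul_exp_mul_fourier_neg {a ε : ℝ} (ha : 0 < a) (hε : 0 < ε) {φ : ℝ → ℂ}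
    (hφ : Integrable φ) :
    ∫ t : ℝ in Set.Ioi 0, ((t ^ (a - 1) : ℝ) : ℂ) * cexp (-(ε * t)) * 𝓕 φ (-t) =
      ∫ ξ : ℝ, Real.Gamma a * (ε - 2 * π * ξ * I : ℂ) ^ (-a : ℂ) * φ ξ := by
  have hf := integrableOn_rpow_mul_cexp_neg_mul ha (r := ε) (by simpa using hε)
  rw [← integrable_indicator_iff measurableSet_Ioi] at hf
  have h := VectorFourier.integral_bilin_fourierIntegral_eq_flip (ContinuousLinearMap.mul ℂ ℂ)
    (L := -(LinearMap.mul ℝ ℝ)) continuous_fourierChar (by simpa using! continuous_mul.neg) hf hφ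
  simp only [ContinuousLinearMap.mul_apply'] at h
  rw [← integral_indicator measurableSet_Ioi]
  convert h.symm using 1
  · congr 1 with t
    rw [Set.indicator_mul_left]
    congr 1
    rw [Real.fourier_real_eq, VectorFourier.fourierIntegral]
    simp [mul_comm]
  · congr 1 with ξ
    congr 1
    rw [← integral_rpow_mul_cexp_neg_mul_Ioi ha (by simpa using hε), VectorFourier.fourierIntegral,
      ← integral_indicator measurableSet_Ioi]
    congr 1 with t
    by_cases ht : t ∈ Set.Ioi (0 : ℝ)
    · simp only [Set.indicator_of_mem ht, Circle.smul_def, Real.fourierChar_apply, smul_eq_mul]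
      rw [mul_left_comm, ← Complex.exp_add]
      congr 2
      simp
      ring
    · simp [Set.indicator_of_notMem ht]

lemma neg_two_pi_mul_I_cpow (c : ℝ) {ξ : ℝ} (hξ : ξ ≠ 0) :
    (-(2 * π * ξ * I) : ℂ) ^ (c - 1 : ℂ) =
      (((2 * π) ^ (c - 1) : ℝ) : ℂ) * (((|ξ| ^ (c - 1) : ℝ) : ℂ) *
        ((Real.sin (π * c / 2) : ℂ) + I * (Real.sign ξ : ℂ) * (Real.cos (π * c / 2) : ℂ))) := by
  have hnorm : ‖(-(2 * π * ξ * I) : ℂ)‖ = 2 * π * |ξ| := by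
    simp [abs_of_pos Real.pi_pos]
  rw [← Complex.ofReal_one, ← Complex.ofReal_sub, Complex.cpow_ofReal, hnorm,
    Real.mul_rpow (by positivity) (abs_nonneg ξ), Complex.ofReal_mul, mul_assoc]
  congr 2
  rcases hξ.lt_or_gt with h | h
  · have harg : (-(2 * π * ξ * I) : ℂ).arg = π / 2 := by
      rw [show (-(2 * π * ξ * I) : ℂ) = ((2 * π * -ξ : ℝ) : ℂ) * I by push_cast; ring,
        Complex.arg_real_mul _ (by have := neg_pos.2 h; positivity), Complex.arg_I]
    rw [harg, show π / 2 * (c - 1) = π * c / 2 - π / 2 by ring, Real.cos_sub_pi_div_two,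
      Real.sin_sub_pi_div_two, Real.sign_of_neg h]
    push_cast
    ring
  · have harg : (-(2 * π * ξ * I) : ℂ).arg = -(π / 2) := by
      rw [show (-(2 * π * ξ * I) : ℂ) = ((2 * π * ξ : ℝ) : ℂ) * -I by push_cast; ring,
        Complex.arg_real_mul _ (by positivity), Complex.arg_neg_I]
    rw [harg, show -(π / 2) * (c - 1) = π / 2 - π * c / 2 by ring, Real.cos_pi_div_two_sub,
      Real.sin_pi_div_two_sub, Real.sign_of_pos h]
    push_cast
    ring

lemma norm_sub_mul_I_cpow_le {c : ℝ} (hc : c ≤ 1) (ε : ℝ) {ξ : ℝ} (hξ : ξ ≠ 0) :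
    ‖(ε - 2 * π * ξ * I : ℂ) ^ (c - 1 : ℂ)‖ ≤ (2 * π) ^ (c - 1) * |ξ| ^ (c - 1) := by
  rw [← Complex.ofReal_one, ← Complex.ofReal_sub, Complex.norm_cpow_real,
    ← Real.mul_rpow (by positivity) (abs_nonneg ξ)]
  refine Real.rpow_le_rpow_of_nonpos (by positivity) ?_ (by linarith)
  refine le_trans (le_of_eq ?_) (Complex.abs_im_le_norm _)
  simp [abs_mul, abs_of_pos Real.pi_pos]

/-- The distributional Fourier transform of
`h_c(x) = |x|^{−c} 1_{(−∞,0)}(x)`, `c ∈ (0,1)`, tested against a Schwartz function: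
`∫_{−∞}^0 (−x)^{−c} 𝓕φ(x) dx
  = Γ(1−c)(2π)^{c−1} ∫ |ξ|^{c−1}(sin(πc/2) + i·sgn(ξ)·cos(πc/2)) φ(ξ) dξ`,
and both integrals converge absolutely. -/
theorem fourier_transform_of_hc
    (c : ℝ) (hc : c ∈ Set.Ioo (0 : ℝ) 1) (φ : SchwartzMap ℝ ℂ) :
    IntegrableOn (fun x : ℝ => (((-x) ^ (-c) : ℝ) : ℂ) * 𝓕 (⇑φ) x) (Set.Iio 0) volume ∧
    Integrable (fun ξ : ℝ => ((|ξ| ^ (c - 1) : ℝ) : ℂ) *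
      ((Real.sin (Real.pi * c / 2) : ℂ) +
        Complex.I * (Real.sign ξ : ℂ) * (Real.cos (Real.pi * c / 2) : ℂ)) * φ ξ) volume ∧
    ∫ x in Set.Iio (0 : ℝ), (((-x) ^ (-c) : ℝ) : ℂ) * 𝓕 (⇑φ) x =
      (Real.Gamma (1 - c) : ℂ) * (((2 * Real.pi) ^ (c - 1) : ℝ) : ℂ) *
        ∫ ξ : ℝ, ((|ξ| ^ (c - 1) : ℝ) : ℂ) *
          ((Real.sin (Real.pi * c / 2) : ℂ) +
            Complex.I * (Real.sign ξ : ℂ) * (Real.cos (Real.pi * c / 2) : ℂ)) * φ ξ := by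
  obtain ⟨hc0, hc1⟩ := hc
  have hbound : ∀ ψ : SchwartzMap ℝ ℂ, ∃ C : ℝ, ∀ x, ‖ψ x‖ ≤ C := fun ψ => by
    obtain ⟨C, hC⟩ := ψ.decay' 0 0
    exact ⟨C, fun x => by simpa using! hC x⟩
  obtain ⟨C, hC⟩ := hbound φ
  obtain ⟨D, hD⟩ := hbound (𝓕 φ)
  rw [SchwartzMap.fourier_coe] at hD
  have hFi : Integrable (𝓕 (⇑φ)) := (𝓕 φ).integrable
  have hFc : Continuous (𝓕 (⇑φ)) := (𝓕 φ).continuous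
  have hL : IntegrableOn (fun t : ℝ => ((t ^ (-c) : ℝ) : ℂ) * 𝓕 (⇑φ) (-t)) (Set.Ioi 0) :=
    integrableOn_Ioi_rpow_mul (by linarith) (by linarith) hFi.comp_neg (by fun_prop)
      fun x => hD (-x)
  have habs : Integrable (fun ξ : ℝ => ((|ξ| ^ (c - 1) : ℝ) : ℂ) * φ ξ) := by
    have hpos := integrableOn_Ioi_rpow_mul (s := c - 1) (by linarith) (by linarith)
      φ.integrable φ.continuous hC
    have hneg := integrableOn_Ioi_rpow_mul (s := c - 1) (by linarith) (by linarith)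
      φ.integrable.comp_neg (by fun_prop) fun x => hC (-x)
    rw [← integrableOn_univ, ← Set.Iic_union_Ioi (a := (0 : ℝ))]
    refine IntegrableOn.union ?_ ?_
    · rw [integrableOn_Iic_iff_integrableOn_Iio]
      rw [← neg_zero] at hneg
      refine hneg.comp_neg_Iio.congr_fun (fun t ht => ?_) measurableSet_Iio
      simp [abs_of_neg (Set.mem_Iio.1 ht)]
    · refine hpos.congr_fun (fun t ht => ?_) measurableSet_Ioi
      simp [abs_of_pos (Set.mem_Ioi.1 ht)]
  have hR : Integrable (fun ξ : ℝ => ((|ξ| ^ (c - 1) : ℝ) : ℂ) *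
      ((Real.sin (π * c / 2) : ℂ) + I * (Real.sign ξ : ℂ) * (Real.cos (π * c / 2) : ℂ)) * φ ξ) := by
    have hsign : Measurable Real.sign :=
      Measurable.ite measurableSet_Iio measurable_const
        (Measurable.ite measurableSet_Ioi measurable_const measurable_const)
    have := habs.bdd_mul (c := 2)
      (f := fun ξ : ℝ => (Real.sin (π * c / 2) : ℂ) +
        I * (Real.sign ξ : ℂ) * (Real.cos (π * c / 2) : ℂ))
      (by fun_prop) (.of_forall fun ξ => ?_)
    · exact this.congr (.of_forall fun ξ => by ring)
    · refine (norm_add_le _ _).trans ?_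
      have h1 : ‖(Real.sin (π * c / 2) : ℂ)‖ ≤ 1 := by
        rw [Complex.norm_real]; exact Real.abs_sin_le_one _
      have h2 : ‖(Real.cos (π * c / 2) : ℂ)‖ ≤ 1 := by
        rw [Complex.norm_real]; exact Real.abs_cos_le_one _
      have h3 : ‖(Real.sign ξ : ℂ)‖ ≤ 1 := by
        rcases Real.sign_apply_eq ξ with h | h | h <;> simp [h]
      have h4 : ‖I * (Real.sign ξ : ℂ) * (Real.cos (π * c / 2) : ℂ)‖ ≤ 1 := by
        rw [norm_mul, norm_mul, Complex.norm_I, one_mul]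
        exact mul_le_one₀ h3 (norm_nonneg _) h2
      linarith
  refine ⟨?_, hR, ?_⟩
  · rw [← neg_zero] at hL
    simpa using hL.comp_neg_Iio
  have hne : ∀ᵐ ξ : ℝ, ξ ≠ 0 := Measure.ae_ne volume 0
  have hreg : ∀ ε : ℝ, 0 < ε →
      ∫ t : ℝ in Set.Ioi 0, ((t ^ (-c) : ℝ) : ℂ) * cexp (-(ε * t)) * 𝓕 (⇑φ) (-t) =
        ∫ ξ : ℝ, Real.Gamma (1 - c) * (ε - 2 * π * ξ * I : ℂ) ^ (c - 1 : ℂ) * φ ξ := by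
    intro ε hε
    have h := integral_rpow_mul_exp_mul_fourier_neg (a := 1 - c) (by linarith) hε φ.integrable
    rw [show 1 - c - 1 = -c by ring] at h
    rw [h]
    push_cast
    simp only [neg_sub]
  have hlimL : Filter.Tendsto (fun ε : ℝ =>
      ∫ t : ℝ in Set.Ioi 0, ((t ^ (-c) : ℝ) : ℂ) * cexp (-(ε * t)) * 𝓕 (⇑φ) (-t))
      (nhdsWithin 0 (Set.Ioi 0))
      (nhds (∫ t : ℝ in Set.Ioi 0, ((t ^ (-c) : ℝ) : ℂ) * 𝓕 (⇑φ) (-t))) := by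
    refine tendsto_integral_filter_of_dominated_convergence _
      (.of_forall fun ε => ?_) ?_ hL.norm (.of_forall fun t => ?_)
    · fun_prop
    · filter_upwards [self_mem_nhdsWithin] with ε hε
      filter_upwards [ae_restrict_mem measurableSet_Ioi] with t ht
      rw [mul_right_comm, norm_mul]
      refine mul_le_of_le_one_right (norm_nonneg _) ?_
      rw [Complex.norm_exp, Real.exp_le_one_iff]
      simpa using (mul_pos hε ht).le
    · have : Continuous fun ε : ℝ =>
          ((t ^ (-c) : ℝ) : ℂ) * cexp (-(ε * t)) * 𝓕 (⇑φ) (-t) := by fun_prop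
      exact (this.tendsto' 0 _ (by simp)).mono_left nhdsWithin_le_nhds
  have hlimR : Filter.Tendsto (fun ε : ℝ =>
      ∫ ξ : ℝ, Real.Gamma (1 - c) * (ε - 2 * π * ξ * I : ℂ) ^ (c - 1 : ℂ) * φ ξ)
      (nhdsWithin 0 (Set.Ioi 0))
      (nhds (∫ ξ : ℝ, Real.Gamma (1 - c) * (-(2 * π * ξ * I) : ℂ) ^ (c - 1 : ℂ) * φ ξ)) := by
    refine tendsto_integral_filter_of_dominated_convergence
      (fun ξ => |Real.Gamma (1 - c)| * (2 * π) ^ (c - 1) * ‖((|ξ| ^ (c - 1) : ℝ) : ℂ) * φ ξ‖)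
      (.of_forall fun ε => ?_) (.of_forall fun ε => ?_) (habs.norm.const_mul _) ?_
    · have : Measurable fun ξ : ℝ => (ε - 2 * π * ξ * I : ℂ) ^ (c - 1 : ℂ) := by fun_prop
      exact (this.aestronglyMeasurable.const_mul _).mul φ.continuous.aestronglyMeasurable
    · filter_upwards [hne] with ξ hξ
      rw [norm_mul, norm_mul, norm_mul, Complex.norm_real, Complex.norm_real, Real.norm_eq_abs,
        Real.norm_of_nonneg (by positivity), ← mul_assoc,
        mul_assoc |Real.Gamma (1 - c)| ((2 * π) ^ (c - 1))]
      gcongr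
      exact norm_sub_mul_I_cpow_le hc1.le ε hξ
    · filter_upwards [hne] with ξ hξ
      have hslit : ((0 : ℝ) - 2 * π * ξ * I : ℂ) ∈ Complex.slitPlane := by
        refine Or.inr ?_
        simpa [Real.pi_ne_zero] using hξ
      have hcont : ContinuousAt (fun ε : ℝ => (ε - 2 * π * ξ * I : ℂ) ^ (c - 1 : ℂ)) 0 :=
        ContinuousAt.cpow (by fun_prop) (by fun_prop) hslit
      have := hcont.tendsto.mono_left (nhdsWithin_le_nhds (s := Set.Ioi (0 : ℝ)))
      simp only [Complex.ofReal_zero, zero_sub] at this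
      exact (this.const_mul _).mul_const _
  have heq := tendsto_nhds_unique (hlimL.congr' (by
    filter_upwards [self_mem_nhdsWithin] with ε hε using hreg ε hε)) hlimR
  have hflip := integral_comp_neg_Ioi 0 fun x : ℝ => (((-x) ^ (-c) : ℝ) : ℂ) * 𝓕 (⇑φ) x
  simp only [neg_neg, neg_zero] at hflip
  rw [← integral_Iic_eq_integral_Iio, ← hflip, heq, ← integral_const_mul]
  refine integral_congr_ae ?_
  filter_upwards [hne] with ξ hξ
  rw [neg_two_pi_mul_I_cpow c hξ]
  ring
end

section
/- Let d ∈ ℕ, d ≥ 1, and let s satisfy 0 ≤ s < d/2. Then there exists a finite constant C = C(s,d) > 0 such that for every Schwartz function f : ℝ^d → ℂ, ( ∫_{ℝ^d} ‖ξ‖^{−2s} |𝓕f(ξ)|² dξ )^{1/2} ≤ C · ‖f‖_{L^{2d/(d+2s)}(ℝ^d)}. -/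
open MeasureTheory
open scoped FourierTransform ENNReal

open Set Real
open scoped ContDiff

section Fourier

variable {E : Type*} [NormedAddCommGroup E] [InnerProductSpace ℝ E] [FiniteDimensional ℝ E]
  [MeasurableSpace E] [BorelSpace E]

theorem enorm_fourier_le_lintegral_enorm (f : E → ℂ) (ξ : E) :
    ‖𝓕 f ξ‖ₑ ≤ ∫⁻ x, ‖f x‖ₑ := by
  rw [Real.fourier_eq]
  refine (enorm_integral_le_lintegral_enorm _).trans_eq ?_
  simp [← ofReal_norm, Circle.norm_smul]

theorem fourier_continuous_of_integrable {f : E → ℂ} (hf : Integrable f) : Continuous (𝓕 f) :=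
  VectorFourier.fourierIntegral_continuous Real.continuous_fourierChar
    (by exact continuous_inner) hf

theorem fourier_ae_eq_fourier_toLp {f : E → ℂ} (hf : Integrable f) (hf2 : MemLp f 2) :
    𝓕 f =ᵐ[volume] (𝓕 (hf2.toLp f) : Lp ℂ 2 (volume : Measure E)) := by
  refine ae_eq_of_integral_contDiff_smul_eq (fourier_continuous_of_integrable hf).locallyIntegrable
    ((Lp.memLp _).locallyIntegrable (by norm_num)) fun g hg hgc => ?_
  have hg₁ : HasCompactSupport (Complex.ofRealCLM ∘ g) := hgc.comp_left rfl
  have hg₂ : ContDiff ℝ ∞ (Complex.ofRealCLM ∘ g) := by fun_prop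
  set φ : SchwartzMap E ℂ := hg₁.toSchwartzMap hg₂ with hφ
  have hφg : ∀ x, φ x = (g x : ℂ) := fun x => by simp [hφ]
  have key := DFunLike.congr_fun (Lp.fourier_toTemperedDistribution_eq (hf2.toLp f)) φ
  rw [TemperedDistribution.fourier_apply, Lp.toTemperedDistribution_apply,
    Lp.toTemperedDistribution_apply] at key
  have hself : ∫ ξ, 𝓕 f ξ • φ ξ = ∫ x, f x • 𝓕 (⇑φ) x := by
    simpa using! VectorFourier.integral_fourierIntegral_smul_eq_flip (L := innerₗ E)
      Real.continuous_fourierChar continuous_inner hf φ.integrable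
  calc ∫ x, g x • 𝓕 f x = ∫ ξ, 𝓕 f ξ • φ ξ := by
        refine integral_congr_ae (.of_forall fun x => ?_)
        simp [hφg, mul_comm]
    _ = ∫ x, (𝓕 φ) x • (hf2.toLp f) x := by
        rw [hself]
        refine integral_congr_ae ?_
        filter_upwards [hf2.coeFn_toLp] with x hx
        rw [hx, SchwartzMap.fourier_coe, smul_eq_mul, smul_eq_mul, mul_comm]
    _ = _ := by
        rw [key]
        refine integral_congr_ae (.of_forall fun x => ?_)
        simp [hφg]

/-- Plancherel's theorem on `L¹ ∩ L²`. -/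
theorem eLpNorm_fourier_eq {f : E → ℂ} (hf : Integrable f) (hf2 : MemLp f 2) :
    eLpNorm (𝓕 f) 2 volume = eLpNorm f 2 volume := by
  rw [eLpNorm_congr_ae (fourier_ae_eq_fourier_toLp hf hf2), ← eLpNorm_congr_ae hf2.coeFn_toLp,
    ← Lp.enorm_def, ← Lp.enorm_def, ← ofReal_norm, ← ofReal_norm, Lp.norm_fourier_eq]

theorem lintegral_enorm_fourier_sq_eq {f : E → ℂ} (hf : Integrable f) (hf2 : MemLp f 2) :
    ∫⁻ ξ, ‖𝓕 f ξ‖ₑ ^ 2 = ∫⁻ x, ‖f x‖ₑ ^ 2 := by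
  have h := congrArg (fun t : ℝ≥0∞ => t ^ 2) (eLpNorm_fourier_eq hf hf2)
  have e (g : E → ℂ) : eLpNorm g 2 volume ^ 2 = ∫⁻ x, ‖g x‖ₑ ^ 2 := by
    simpa using eLpNorm_nnreal_pow_eq_lintegral (f := g) (μ := volume) (p := 2) (by norm_num)
  simpa only [e] using h

theorem setLIntegral_ball_enorm_fourier_add_sq_le {g h : E → ℂ} (hg : Integrable g)
    (hg2 : MemLp g 2) (hh : Integrable h) (R : ℝ) :
    ∫⁻ ξ in Metric.ball 0 R, ‖𝓕 (g + h) ξ‖ₑ ^ 2 ≤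
      2 * (∫⁻ x, ‖g x‖ₑ ^ 2) + 2 * (volume (Metric.ball (0 : E) R) * (∫⁻ x, ‖h x‖ₑ) ^ 2) := by
  have hadd : 𝓕 (g + h) = 𝓕 g + 𝓕 h :=
    VectorFourier.fourierIntegral_add (L := innerₗ E) Real.continuous_fourierChar
      (by exact continuous_inner) hg hh
  have hm := (fourier_continuous_of_integrable hg).measurable
  calc ∫⁻ ξ in Metric.ball 0 R, ‖𝓕 (g + h) ξ‖ₑ ^ 2
      ≤ ∫⁻ ξ in Metric.ball 0 R, (2 * ‖𝓕 g ξ‖ₑ ^ 2 + 2 * (∫⁻ x, ‖h x‖ₑ) ^ 2) := by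
        refine lintegral_mono fun ξ => ?_
        rw [hadd, Pi.add_apply, ← mul_add]
        calc ‖𝓕 g ξ + 𝓕 h ξ‖ₑ ^ 2 ≤ (‖𝓕 g ξ‖ₑ + ∫⁻ x, ‖h x‖ₑ) ^ 2 := by
              gcongr
              exact (enorm_add_le _ _).trans
                (by gcongr; exact enorm_fourier_le_lintegral_enorm h ξ)
          _ ≤ _ := by
              have := ENNReal.rpow_add_le_mul_rpow_add_rpow ‖𝓕 g ξ‖ₑ (∫⁻ x, ‖h x‖ₑ)
                (p := 2) (by norm_num)
              norm_num at this
              exact this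
    _ ≤ _ := by
        rw [lintegral_add_right _ measurable_const, lintegral_const_mul _ (hm.enorm.pow_const 2),
          lintegral_const, Measure.restrict_apply_univ, mul_assoc 2, mul_comm (_ ^ 2),
          ← lintegral_enorm_fourier_sq_eq hg hg2]
        gcongr
        exact Measure.restrict_le_self

end Fourier

theorem lintegral_Ioi_rpow_neg {a r : ℝ} (ha : 0 < a) (hr : 0 < r) :
    ∫⁻ t in Ioi r, ENNReal.ofReal (t ^ (-a - 1)) = ENNReal.ofReal (r ^ (-a) / a) := by
  rw [← ofReal_integral_eq_lintegral_ofReal (integrableOn_Ioi_rpow_of_lt (by linarith) hr)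
    ((ae_restrict_iff' measurableSet_Ioi).2
      (.of_forall fun t ht => rpow_nonneg (hr.trans ht).le _)),
    integral_Ioi_rpow_of_lt (by linarith) hr]
  congr 1
  rw [sub_add_cancel, div_neg, neg_div, neg_neg]

theorem lintegral_Ioc_rpow {b r : ℝ} (hb : 0 < b) (hr : 0 ≤ r) :
    ∫⁻ t in Ioc 0 r, ENNReal.ofReal (t ^ (b - 1)) = ENNReal.ofReal (r ^ b / b) := by
  rw [← ofReal_integral_eq_lintegral_ofReal
    ((intervalIntegrable_iff_integrableOn_Ioc_of_le hr).1
      (intervalIntegral.intervalIntegrable_rpow' (by linarith)))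
    ((ae_restrict_iff' measurableSet_Ioc).2
      (.of_forall fun t ht => rpow_nonneg ht.1.le _)),
    ← intervalIntegral.integral_of_le hr, integral_rpow (Or.inl (by linarith))]
  simp [zero_rpow hb.ne']

section LayerCake

variable {X : Type*} [MeasurableSpace X] {μ : Measure X} {f : X → ℂ}

theorem lintegral_rpow_mul_lintegral_indicator_lt_sq_le [SFinite μ] (hf : Measurable f)
    {a α : ℝ} (ha : 0 < a) :
    ∫⁻ t in Ioi 0, ENNReal.ofReal (t ^ (-a - 1)) *
        ∫⁻ x, ‖{x | ‖f x‖ ^ α < t}.indicator f x‖ₑ ^ 2 ∂μ ≤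
      ENNReal.ofReal a⁻¹ * ∫⁻ x, ENNReal.ofReal (‖f x‖ ^ (2 - α * a)) ∂μ := by
  have hv : Measurable fun x => ‖f x‖ ^ α := hf.norm.pow_const α
  have hjoint : Measurable fun q : ℝ × X => ENNReal.ofReal (q.1 ^ (-a - 1)) *
      ‖{x | ‖f x‖ ^ α < q.1}.indicator f q.2‖ₑ ^ 2 := by
    have hset : MeasurableSet {q : ℝ × X | ‖f q.2‖ ^ α < q.1} :=
      measurableSet_lt (hv.comp measurable_snd) measurable_fst
    exact (measurable_fst.pow_const _).ennreal_ofReal.mul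
      (((hf.comp measurable_snd).indicator hset).enorm.pow_const 2)
  calc _ = ∫⁻ t in Ioi 0, ∫⁻ x, ENNReal.ofReal (t ^ (-a - 1)) *
        ‖{x | ‖f x‖ ^ α < t}.indicator f x‖ₑ ^ 2 ∂μ := by
        refine lintegral_congr fun t => (lintegral_const_mul _ ?_).symm
        exact (hf.indicator (measurableSet_lt hv measurable_const)).enorm.pow_const 2
    _ = ∫⁻ x, (∫⁻ t in Ioi (0 : ℝ), ENNReal.ofReal (t ^ (-a - 1)) *
        ‖{x | ‖f x‖ ^ α < t}.indicator f x‖ₑ ^ 2) ∂μ :=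
        lintegral_lintegral_swap hjoint.aemeasurable
    _ ≤ ∫⁻ x, ENNReal.ofReal a⁻¹ * ENNReal.ofReal (‖f x‖ ^ (2 - α * a)) ∂μ := by
        refine lintegral_mono fun x => ?_
        by_cases hx : f x = 0
        · simp [indicator, hx]
        have hpos : 0 < ‖f x‖ := norm_pos_iff.2 hx
        calc _ ≤ ∫⁻ t : ℝ, (Ioi (‖f x‖ ^ α)).indicator
              (fun t => ENNReal.ofReal (t ^ (-a - 1)) * ‖f x‖ₑ ^ 2) t := by
              refine (setLIntegral_le_lintegral _ _).trans (lintegral_mono fun t => ?_)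
              by_cases h : ‖f x‖ ^ α < t <;> simp [indicator, h]
          _ = ENNReal.ofReal ((‖f x‖ ^ α) ^ (-a) / a) * ‖f x‖ₑ ^ 2 := by
              rw [lintegral_indicator measurableSet_Ioi, lintegral_mul_const'' _ (by fun_prop),
                lintegral_Ioi_rpow_neg ha (rpow_pos_of_pos hpos α)]
          _ = _ := by
              rw [← ofReal_norm, ← ENNReal.ofReal_pow hpos.le,
                ← ENNReal.ofReal_mul (by positivity), ← ENNReal.ofReal_mul (by positivity),
                ← rpow_mul hpos.le, rpow_sub hpos, mul_neg, rpow_neg hpos.le, rpow_two]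
              congr 1
              field_simp
    _ = _ := lintegral_const_mul _ (hf.norm.pow_const _).ennreal_ofReal

theorem lintegral_rpow_mul_lintegral_indicator_ge_le [SFinite μ] (hf : Measurable f)
    {b α : ℝ} (hb : 0 < b) :
    ∫⁻ t in Ioi 0, ENNReal.ofReal (t ^ (b - 1)) *
        ∫⁻ x, ‖{x | t ≤ ‖f x‖ ^ α}.indicator f x‖ₑ ∂μ ≤
      ENNReal.ofReal b⁻¹ * ∫⁻ x, ENNReal.ofReal (‖f x‖ ^ (1 + α * b)) ∂μ := by
  have hv : Measurable fun x => ‖f x‖ ^ α := hf.norm.pow_const α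
  have hjoint : Measurable fun q : ℝ × X => ENNReal.ofReal (q.1 ^ (b - 1)) *
      ‖{x | q.1 ≤ ‖f x‖ ^ α}.indicator f q.2‖ₑ := by
    have hset : MeasurableSet {q : ℝ × X | q.1 ≤ ‖f q.2‖ ^ α} :=
      measurableSet_le measurable_fst (hv.comp measurable_snd)
    exact (measurable_fst.pow_const _).ennreal_ofReal.mul
      ((hf.comp measurable_snd).indicator hset).enorm
  calc _ = ∫⁻ t in Ioi 0, ∫⁻ x, ENNReal.ofReal (t ^ (b - 1)) *
        ‖{x | t ≤ ‖f x‖ ^ α}.indicator f x‖ₑ ∂μ := by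
        refine lintegral_congr fun t => (lintegral_const_mul _ ?_).symm
        exact (hf.indicator (measurableSet_le measurable_const hv)).enorm
    _ = ∫⁻ x, (∫⁻ t in Ioi (0 : ℝ), ENNReal.ofReal (t ^ (b - 1)) *
        ‖{x | t ≤ ‖f x‖ ^ α}.indicator f x‖ₑ) ∂μ :=
        lintegral_lintegral_swap hjoint.aemeasurable
    _ ≤ ∫⁻ x, ENNReal.ofReal b⁻¹ * ENNReal.ofReal (‖f x‖ ^ (1 + α * b)) ∂μ := by
        refine lintegral_mono fun x => ?_
        by_cases hx : f x = 0
        · simp [indicator, hx]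
        have hpos : 0 < ‖f x‖ := norm_pos_iff.2 hx
        calc _ = ∫⁻ t : ℝ, (Ioc 0 (‖f x‖ ^ α)).indicator
              (fun t => ENNReal.ofReal (t ^ (b - 1)) * ‖f x‖ₑ) t := by
              rw [← lintegral_indicator measurableSet_Ioi]
              refine lintegral_congr fun t => ?_
              by_cases h : t ≤ ‖f x‖ ^ α <;> by_cases h0 : 0 < t <;> simp [indicator, h, h0]
          _ = ENNReal.ofReal ((‖f x‖ ^ α) ^ b / b) * ‖f x‖ₑ := by
              rw [lintegral_indicator measurableSet_Ioc, lintegral_mul_const'' _ (by fun_prop),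
                lintegral_Ioc_rpow hb (by positivity)]
          _ ≤ _ := by
              rw [← ofReal_norm, ← ENNReal.ofReal_mul (by positivity),
                ← ENNReal.ofReal_mul (by positivity), ← rpow_mul hpos.le, rpow_add hpos, rpow_one]
              apply le_of_eq
              congr 1
              field_simp
    _ = _ := lintegral_const_mul _ (hf.norm.pow_const _).ennreal_ofReal

theorem rpow_mul_lintegral_indicator_ge_le (hf : Measurable f) {b α t : ℝ} (hb : 0 ≤ b)
    (ht : 0 < t) :
    ENNReal.ofReal (t ^ b) * ∫⁻ x, ‖{x | t ≤ ‖f x‖ ^ α}.indicator f x‖ₑ ∂μ ≤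
      ∫⁻ x, ENNReal.ofReal (‖f x‖ ^ (1 + α * b)) ∂μ := by
  have hv : Measurable fun x => ‖f x‖ ^ α := hf.norm.pow_const α
  rw [← lintegral_const_mul _ (hf.indicator (measurableSet_le measurable_const hv)).enorm]
  refine lintegral_mono fun x => ?_
  by_cases hx : f x = 0
  · simp [indicator, hx]
  have hpos : 0 < ‖f x‖ := norm_pos_iff.2 hx
  by_cases h : t ≤ ‖f x‖ ^ α
  · simp only [indicator, mem_ofPred_eq, h, if_true]
    rw [← ofReal_norm, ← ENNReal.ofReal_mul (by positivity), rpow_add hpos, rpow_one,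
      rpow_mul hpos.le, mul_comm]
    gcongr
  · simp [indicator, h]

theorem lintegral_rpow_mul_lintegral_indicator_ge_sq_le [SFinite μ] (hf : Measurable f)
    {b α : ℝ} (hb : 0 < b) :
    ∫⁻ t in Ioi 0, ENNReal.ofReal (t ^ (b - 1)) *
        (∫⁻ x, ‖{x | t ≤ ‖f x‖ ^ α}.indicator f x‖ₑ ∂μ) ^ 2 ≤
      ENNReal.ofReal (b / 2)⁻¹ * (∫⁻ x, ENNReal.ofReal (‖f x‖ ^ (1 + α * (b / 2))) ∂μ) ^ 2 := by
  set M := ∫⁻ x, ENNReal.ofReal (‖f x‖ ^ (1 + α * (b / 2))) ∂μ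
  have hH : Measurable fun t : ℝ => ∫⁻ x, ‖{x | t ≤ ‖f x‖ ^ α}.indicator f x‖ₑ ∂μ := by
    have hset : MeasurableSet {q : ℝ × X | q.1 ≤ ‖f q.2‖ ^ α} :=
      measurableSet_le measurable_fst ((hf.norm.pow_const α).comp measurable_snd)
    have h : Measurable fun q : ℝ × X => ‖{x | q.1 ≤ ‖f x‖ ^ α}.indicator f q.2‖ₑ :=
      ((hf.comp measurable_snd).indicator hset).enorm
    exact h.lintegral_prod_right'
  calc _ ≤ ∫⁻ t in Ioi 0, M * (ENNReal.ofReal (t ^ (b / 2 - 1)) *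
        ∫⁻ x, ‖{x | t ≤ ‖f x‖ ^ α}.indicator f x‖ₑ ∂μ) := by
        refine setLIntegral_mono' measurableSet_Ioi fun t (ht : 0 < t) => ?_
        have : t ^ (b - 1) = t ^ (b / 2) * t ^ (b / 2 - 1) := by
          rw [← rpow_add ht]; ring_nf
        rw [this, ENNReal.ofReal_mul (by positivity), sq, mul_mul_mul_comm]
        gcongr
        exact rpow_mul_lintegral_indicator_ge_le hf (by positivity) ht
    _ = M * ∫⁻ t in Ioi 0, (ENNReal.ofReal (t ^ (b / 2 - 1)) *
        ∫⁻ x, ‖{x | t ≤ ‖f x‖ ^ α}.indicator f x‖ₑ ∂μ) :=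
        lintegral_const_mul _ ((measurable_id.pow_const _).ennreal_ofReal.mul hH)
    _ ≤ M * (ENNReal.ofReal (b / 2)⁻¹ * M) := by
        gcongr
        exact lintegral_rpow_mul_lintegral_indicator_ge_le hf (by positivity)
    _ = _ := by ring

end LayerCake

section Sobolev

variable {E : Type*} [NormedAddCommGroup E] [InnerProductSpace ℝ E] [FiniteDimensional ℝ E]
  [MeasurableSpace E] [BorelSpace E]

/-- Layer-cake bound of a power weight by integrals over balls. -/
theorem lintegral_norm_rpow_mul_le {a : ℝ} (ha : 0 < a) {F : E → ℝ≥0∞} (hF : Measurable F) :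
    ∫⁻ ξ, ENNReal.ofReal (‖ξ‖ ^ (-a)) * F ξ ≤
      ENNReal.ofReal a * ∫⁻ t in Ioi (0 : ℝ), ENNReal.ofReal (t ^ (-a - 1)) *
        ∫⁻ ξ in Metric.ball 0 t, F ξ := by
  have hjoint : Measurable fun q : E × ℝ => ENNReal.ofReal (q.2 ^ (-a - 1)) *
      (Metric.ball 0 q.2).indicator F q.1 := by
    have hset : MeasurableSet {q : E × ℝ | dist q.1 0 < q.2} :=
      measurableSet_lt (measurable_fst.dist measurable_const) measurable_snd
    exact (measurable_snd.pow_const _).ennreal_ofReal.mul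
      ((hF.comp measurable_fst).indicator hset)
  calc ∫⁻ ξ, ENNReal.ofReal (‖ξ‖ ^ (-a)) * F ξ
      ≤ ∫⁻ ξ, ENNReal.ofReal a * ∫⁻ t in Ioi (0 : ℝ), ENNReal.ofReal (t ^ (-a - 1)) *
          (Metric.ball 0 t).indicator F ξ := by
        refine lintegral_mono fun ξ => ?_
        rcases eq_or_ne ξ 0 with rfl | hξ
        · simp [zero_rpow (neg_ne_zero.2 ha.ne')]
        have hpos : 0 < ‖ξ‖ := norm_pos_iff.2 hξ
        have h : ∫⁻ t in Ioi (0 : ℝ), ENNReal.ofReal (t ^ (-a - 1)) *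
            (Metric.ball 0 t).indicator F ξ = ENNReal.ofReal (‖ξ‖ ^ (-a) / a) * F ξ := by
          rw [← lintegral_Ioi_rpow_neg ha hpos, ← lintegral_mul_const'' _ (by fun_prop),
            ← lintegral_indicator measurableSet_Ioi, ← lintegral_indicator measurableSet_Ioi]
          refine lintegral_congr fun t => ?_
          by_cases h : ‖ξ‖ < t
          · simp [indicator, h, hpos.trans h]
          · simp [indicator, h]
        rw [h, ← mul_assoc, ← ENNReal.ofReal_mul ha.le, mul_div_cancel₀ _ ha.ne']
    _ = ENNReal.ofReal a * ∫⁻ t in Ioi (0 : ℝ), (∫⁻ ξ, ENNReal.ofReal (t ^ (-a - 1)) *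
          (Metric.ball 0 t).indicator F ξ) := by
        rw [lintegral_const_mul _ hjoint.lintegral_prod_right',
          lintegral_lintegral_swap hjoint.aemeasurable]
    _ = _ := by
        congr 1
        refine lintegral_congr fun t => ?_
        rw [lintegral_const_mul _ (hF.indicator measurableSet_ball),
          lintegral_indicator measurableSet_ball]

theorem lintegral_norm_rpow_mul_enorm_fourier_sq_le {s : ℝ} (hs : 0 < s)
    (hsd : 2 * s < Module.finrank ℝ E) {f : E → ℂ} (hfm : Measurable f) (hf : Integrable f)
    (hf2 : MemLp f 2) {M : ℝ≥0∞}
    (hM : ∫⁻ x, ENNReal.ofReal (‖f x‖ ^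
      (2 * Module.finrank ℝ E / (Module.finrank ℝ E + 2 * s) : ℝ)) = M) :
    ∫⁻ ξ, ENNReal.ofReal (‖ξ‖ ^ (-(2 * s))) * ‖𝓕 f ξ‖ₑ ^ 2 ≤
      ENNReal.ofReal (2 * s) * (2 * (ENNReal.ofReal (2 * s)⁻¹ * M) +
        2 * volume (Metric.ball (0 : E) 1) *
          (ENNReal.ofReal ((Module.finrank ℝ E - 2 * s) / 2)⁻¹ * M ^ 2)) := by
  set n := Module.finrank ℝ E with hn
  have hb : 0 < (n : ℝ) - 2 * s := by linarith
  have hn0 : (n : ℝ) + 2 * s ≠ 0 := by positivity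
  set α : ℝ := 2 / (n + 2 * s) with hα
  have hlow := lintegral_rpow_mul_lintegral_indicator_lt_sq_le (μ := volume) hfm
    (α := α) (mul_pos two_pos hs)
  have hhigh := lintegral_rpow_mul_lintegral_indicator_ge_sq_le (μ := volume) hfm (α := α) hb
  have e1 : 2 - α * (2 * s) = 2 * n / (n + 2 * s) := by rw [hα]; field_simp; ring
  have e2 : 1 + α * ((n - 2 * s) / 2) = 2 * n / (n + 2 * s) := by rw [hα]; field_simp; ring
  rw [e1, hM] at hlow
  rw [e2, hM] at hhigh
  have hv : Measurable fun x => ‖f x‖ ^ α := hfm.norm.pow_const α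
  have hcont := fourier_continuous_of_integrable hf
  refine (lintegral_norm_rpow_mul_le (mul_pos two_pos hs)
    (hcont.measurable.enorm.pow_const 2)).trans ?_
  gcongr
  have hsplit (t : ℝ) (ht : t ∈ Ioi (0 : ℝ)) :
      ENNReal.ofReal (t ^ (-(2 * s) - 1)) * ∫⁻ ξ in Metric.ball 0 t, ‖𝓕 f ξ‖ₑ ^ 2 ≤
        2 * (ENNReal.ofReal (t ^ (-(2 * s) - 1)) *
          ∫⁻ x, ‖{x | ‖f x‖ ^ α < t}.indicator f x‖ₑ ^ 2) +
        2 * volume (Metric.ball (0 : E) 1) * (ENNReal.ofReal (t ^ (n - 2 * s - 1)) *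
          (∫⁻ x, ‖{x | t ≤ ‖f x‖ ^ α}.indicator f x‖ₑ) ^ 2) := by
    have ht : 0 < t := ht
    have hset : MeasurableSet {x | ‖f x‖ ^ α < t} := measurableSet_lt hv measurable_const
    have hset' : MeasurableSet {x | t ≤ ‖f x‖ ^ α} := measurableSet_le measurable_const hv
    have hfs : {x | ‖f x‖ ^ α < t}.indicator f + {x | t ≤ ‖f x‖ ^ α}.indicator f = f := by
      ext x
      by_cases h : ‖f x‖ ^ α < t
      · simp [indicator, h, h.not_ge]
      · simp [indicator, h, not_lt.1 h]
    have h := setLIntegral_ball_enorm_fourier_add_sq_le (hf.indicator hset)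
      (hf2.indicator hset) (hf.indicator hset') t
    rw [hfs, Measure.addHaar_ball_of_pos _ _ ht, ← hn] at h
    have ht' : t ^ ((n : ℝ) - 2 * s - 1) = t ^ (-(2 * s) - 1) * t ^ n := by
      rw [← rpow_natCast, ← rpow_add ht]; ring_nf
    rw [ht', ENNReal.ofReal_mul (by positivity)]
    refine (mul_le_mul_right h _).trans_eq ?_
    ring
  refine (setLIntegral_mono' measurableSet_Ioi hsplit).trans ?_
  have hmeas : Measurable fun t : ℝ => ENNReal.ofReal (t ^ (-(2 * s) - 1)) *
      ∫⁻ x, ‖{x | ‖f x‖ ^ α < t}.indicator f x‖ₑ ^ 2 := by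
    have hset : MeasurableSet {q : ℝ × E | ‖f q.2‖ ^ α < q.1} :=
      measurableSet_lt (hv.comp measurable_snd) measurable_fst
    have h : Measurable fun q : ℝ × E => ‖{x | ‖f x‖ ^ α < q.1}.indicator f q.2‖ₑ ^ 2 :=
      ((hfm.comp measurable_snd).indicator hset).enorm.pow_const 2
    exact (measurable_id.pow_const _).ennreal_ofReal.mul h.lintegral_prod_right'
  rw [lintegral_add_left (hmeas.const_mul 2), lintegral_const_mul _ hmeas,
    lintegral_const_mul' _ _ (ENNReal.mul_ne_top (by simp) measure_ball_lt_top.ne)]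
  gcongr

theorem lintegral_norm_rpow_mul_enorm_fourier_sq_rpow_le {s p : ℝ} (hs : 0 < s)
    (hsd : 2 * s < Module.finrank ℝ E)
    (hp : p = 2 * Module.finrank ℝ E / (Module.finrank ℝ E + 2 * s)) {f : E → ℂ}
    (hfm : Measurable f) (hf : Integrable f) (hf2 : MemLp f 2)
    (hfp : MemLp f (ENNReal.ofReal p)) :
    (∫⁻ ξ, ENNReal.ofReal (‖ξ‖ ^ (-(2 * s))) * ‖𝓕 f ξ‖ₑ ^ 2) ^ (1 / 2 : ℝ) ≤
      (ENNReal.ofReal (2 * s) * (2 * ENNReal.ofReal (2 * s)⁻¹ +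
        2 * volume (Metric.ball (0 : E) 1) *
          ENNReal.ofReal ((Module.finrank ℝ E - 2 * s) / 2)⁻¹)) ^ (1 / 2 : ℝ) *
      eLpNorm f (ENNReal.ofReal p) volume := by
  have hp0 : 0 < p := by
    have : (0 : ℝ) < Module.finrank ℝ E := by linarith
    rw [hp]; positivity
  have hp0' : ENNReal.ofReal p ≠ 0 := by simpa using hp0
  obtain ⟨N, hN⟩ : ∃ N, eLpNorm f (ENNReal.ofReal p) volume = N := ⟨_, rfl⟩
  have hNtop : N ≠ ⊤ := hN ▸ hfp.eLpNorm_ne_top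
  rcases eq_or_ne N 0 with hN0 | hN0
  · have hf0 : f =ᵐ[volume] 0 := (eLpNorm_eq_zero_iff hf.1 hp0').1 (hN.trans hN0)
    have hz (ξ : E) : 𝓕 f ξ = 0 := by
      rw [Real.fourier_congr_ae hf0]
      simp [Real.fourier_eq]
    simp [hz]
  obtain ⟨c, hc0, hcN⟩ : ∃ c : ℝ, 0 < c ∧ ENNReal.ofReal c = N :=
    ⟨N.toReal, ENNReal.toReal_pos hN0 hNtop, ENNReal.ofReal_toReal hNtop⟩
  have hcnorm : ‖(c : ℂ)‖ₑ = N := by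
    rw [← ofReal_norm, Complex.norm_real, norm_of_nonneg hc0.le, hcN]
  obtain ⟨g, hg⟩ : ∃ g : E → ℂ, g = (c : ℂ)⁻¹ • f := ⟨_, rfl⟩
  have hfg : f = (c : ℂ) • g := by
    rw [hg, smul_inv_smul₀ (by exact_mod_cast hc0.ne')]
  have hgN : eLpNorm g (ENNReal.ofReal p) volume = 1 := by
    rw [hfg, eLpNorm_const_smul, hcnorm] at hN
    exact (ENNReal.mul_right_inj hN0 hNtop).1 (hN.trans (mul_one N).symm)
  have hgM : ∫⁻ x, ENNReal.ofReal (‖g x‖ ^ p) = 1 := by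
    have h := congrArg (· ^ p) hgN
    simp only [ENNReal.one_rpow] at h
    rw [eLpNorm_eq_lintegral_rpow_enorm_toReal hp0' ENNReal.ofReal_ne_top,
      ENNReal.toReal_ofReal hp0.le, ← ENNReal.rpow_mul, one_div, inv_mul_cancel₀ hp0.ne',
      ENNReal.rpow_one] at h
    rw [← h]
    refine lintegral_congr fun x => ?_
    rw [← ofReal_norm, ENNReal.ofReal_rpow_of_nonneg (norm_nonneg _) hp0.le]
  have hmain := lintegral_norm_rpow_mul_enorm_fourier_sq_le hs hsd (f := g) (M := 1)
    (hg ▸ hfm.const_smul _) (hg ▸ hf.smul _) (hg ▸ hf2.const_smul _) (hp ▸ hgM)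
  rw [mul_one, one_pow, mul_one] at hmain
  have hF (ξ : E) : ‖𝓕 f ξ‖ₑ = N * ‖𝓕 g ξ‖ₑ := by
    have : 𝓕 f ξ = (c : ℂ) • 𝓕 g ξ := by
      rw [hfg]
      exact congrFun (VectorFourier.fourierIntegral_const_smul Real.fourierChar volume
        (innerₗ E) g (c : ℂ)) ξ
    rw [this, enorm_smul, hcnorm]
  calc (∫⁻ ξ, ENNReal.ofReal (‖ξ‖ ^ (-(2 * s))) * ‖𝓕 f ξ‖ₑ ^ 2) ^ (1 / 2 : ℝ)
      = (N ^ 2 * ∫⁻ ξ, ENNReal.ofReal (‖ξ‖ ^ (-(2 * s))) * ‖𝓕 g ξ‖ₑ ^ 2) ^ (1 / 2 : ℝ) := by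
        rw [← lintegral_const_mul' _ _ (by finiteness)]
        congr 1
        refine lintegral_congr fun ξ => ?_
        rw [hF]
        ring
    _ = (∫⁻ ξ, ENNReal.ofReal (‖ξ‖ ^ (-(2 * s))) * ‖𝓕 g ξ‖ₑ ^ 2) ^ (1 / 2 : ℝ) * N := by
        rw [ENNReal.mul_rpow_of_nonneg _ _ (by norm_num), ← ENNReal.rpow_natCast,
          ← ENNReal.rpow_mul, mul_comm]
        norm_num
    _ ≤ _ := by
        rw [hN]
        gcongr

end Sobolev

/-- Embedding of `L^{2d/(d+2s)}(ℝ^d)` into the homogeneous Sobolev space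
`Ẇ^{−s,2}(ℝ^d)`: for `0 ≤ s < d/2` there is a constant `C > 0` such that
`(∫ ‖ξ‖^{−2s} |𝓕f(ξ)|² dξ)^{1/2} ≤ C ‖f‖_{L^{2d/(d+2s)}}` for all Schwartz `f`. -/
theorem homogeneous_sobolev_embedding_neg
    (d : ℕ) (hd : 1 ≤ d) (s : ℝ) (hs : 0 ≤ s) (hsd : s < d / 2) :
    ∃ C : ℝ, 0 < C ∧
      ∀ f : SchwartzMap (EuclideanSpace ℝ (Fin d)) ℂ,
        (∫⁻ ξ : EuclideanSpace ℝ (Fin d),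
            ENNReal.ofReal (‖ξ‖ ^ (-(2 * s)) * ‖𝓕 (⇑f) ξ‖ ^ 2)) ^ ((1 : ℝ) / 2) ≤
          ENNReal.ofReal C *
            eLpNorm (⇑f) (ENNReal.ofReal (2 * d / (d + 2 * s))) volume := by
  have hd0 : (0 : ℝ) < d := by exact_mod_cast hd
  have hrw (f : SchwartzMap (EuclideanSpace ℝ (Fin d)) ℂ) (ξ : EuclideanSpace ℝ (Fin d)) :
      ENNReal.ofReal (‖ξ‖ ^ (-(2 * s)) * ‖𝓕 (⇑f) ξ‖ ^ 2) =
        ENNReal.ofReal (‖ξ‖ ^ (-(2 * s))) * ‖𝓕 (⇑f) ξ‖ₑ ^ 2 := by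
    rw [ENNReal.ofReal_mul (by positivity), ENNReal.ofReal_pow (norm_nonneg _), ofReal_norm]
  simp_rw [hrw]
  rcases hs.eq_or_lt with rfl | hs
  · refine ⟨1, one_pos, fun f => ?_⟩
    have e : ENNReal.ofReal (2 * d / (d + 2 * 0)) = 2 := by
      rw [mul_zero, add_zero, mul_div_cancel_right₀ _ hd0.ne']; simp
    rw [e, eLpNorm_eq_lintegral_rpow_enorm_toReal two_ne_zero ENNReal.ofNat_ne_top]
    simp [lintegral_enorm_fourier_sq_eq f.integrable (f.memLp 2)]
  obtain ⟨K, hK⟩ : ∃ K, K = (ENNReal.ofReal (2 * s) * (2 * ENNReal.ofReal (2 * s)⁻¹ +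
      2 * volume (Metric.ball (0 : EuclideanSpace ℝ (Fin d)) 1) *
        ENNReal.ofReal ((d - 2 * s) / 2)⁻¹)) ^ (1 / 2 : ℝ) := ⟨_, rfl⟩
  have hKtop : K ≠ ⊤ := by
    have := (measure_ball_lt_top (μ := volume) (x := (0 : EuclideanSpace ℝ (Fin d))) (r := 1)).ne
    rw [hK]
    finiteness
  refine ⟨K.toReal + 1, by positivity, fun f => ?_⟩
  have h := lintegral_norm_rpow_mul_enorm_fourier_sq_rpow_le (E := EuclideanSpace ℝ (Fin d))
    (p := 2 * d / (d + 2 * s)) hs (by rw [finrank_euclideanSpace_fin]; linarith)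
    (by rw [finrank_euclideanSpace_fin]) f.continuous.measurable f.integrable (f.memLp 2)
    (f.memLp _)
  rw [finrank_euclideanSpace_fin, ← hK] at h
  refine h.trans ?_
  gcongr
  rw [← ENNReal.ofReal_toReal hKtop]
  exact ENNReal.ofReal_le_ofReal (by simp)
end

section
/- Let d ∈ ℕ, d ≥ 1, and let s satisfy 0 ≤ s < d/2. Then there exists a finite constant C = C(s,d) > 0 such that for every Schwartz function f : ℝ^d → ℂ, ‖f‖_{L^{2d/(d−2s)}(ℝ^d)} ≤ C · ( ∫_{ℝ^d} ‖ξ‖^{2s} |𝓕f(ξ)|² dξ )^{1/2}. -/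
open MeasureTheory
open scoped FourierTransform ENNReal

open Metric SchwartzMap

section HomogeneousSobolev

variable {V : Type*} [NormedAddCommGroup V] [InnerProductSpace ℝ V] [FiniteDimensional ℝ V]
  [MeasurableSpace V] [BorelSpace V]
  {H : Type*} [NormedAddCommGroup H] [InnerProductSpace ℂ H] [CompleteSpace H]

/-- Plancherel's theorem for Schwartz functions, in terms of lower Lebesgue integrals. -/
theorem lintegral_enorm_sq_fourier (f : SchwartzMap V H) :
    ∫⁻ ξ, ‖𝓕 f ξ‖ₑ ^ 2 = ∫⁻ x, ‖f x‖ₑ ^ 2 := by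
  have key (g : SchwartzMap V H) :
      ∫⁻ x, ‖g x‖ₑ ^ 2 = ENNReal.ofReal (∫ x, ‖g x‖ ^ 2) := by
    rw [ofReal_integral_eq_lintegral_ofReal
      (MemLp.integrable_norm_pow (p := 2) (mod_cast g.memLp 2 volume) two_ne_zero)
      (.of_forall fun _ ↦ by positivity)]
    refine lintegral_congr fun x ↦ ?_
    rw [ENNReal.ofReal_pow (norm_nonneg _), ofReal_norm]
  rw [key, key, integral_norm_sq_fourier]

/-- The integral of a power of the norm over a centered ball scales with the radius. -/
theorem setIntegral_ball_norm_rpow (a : ℝ) {R : ℝ} (hR : 0 < R) :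
    ∫ x in ball (0 : V) R, ‖x‖ ^ a =
      R ^ (Module.finrank ℝ V + a) * ∫ x in ball (0 : V) 1, ‖x‖ ^ a := by
  have h := Measure.setIntegral_comp_smul_of_pos (volume : Measure V) (fun x ↦ ‖x‖ ^ a)
    (ball 0 1) hR
  simp only [norm_smul, Real.norm_of_nonneg hR.le, Real.mul_rpow hR.le (norm_nonneg _),
    smul_unitBall_of_pos hR, integral_const_mul, smul_eq_mul] at h
  rw [Real.rpow_add hR, Real.rpow_natCast, mul_assoc, h,
    mul_inv_cancel_left₀ (by positivity)]

theorem integrableOn_ball_norm_rpow (hn : 1 ≤ Module.finrank ℝ V) {a : ℝ}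
    (ha : -Module.finrank ℝ V < a) (R : ℝ) :
    IntegrableOn (fun x : V ↦ ‖x‖ ^ a) (ball 0 R) := by
  have h : LocallyIntegrable (fun x : V ↦ ‖x‖ ^ a) :=
    locallyIntegrable_of_norm_le_rpow (C := 1) (α := -a) hn (by linarith)
      (.of_forall fun x ↦ by rw [neg_neg, one_mul, Real.norm_of_nonneg (by positivity)])
      (by measurability : Measurable fun x : V ↦ ‖x‖ ^ a).aestronglyMeasurable
  exact (h.integrableOn_isCompact (isCompact_closedBall 0 R)).mono_set ball_subset_closedBall

/-- The `L¹` norm on a centered ball is controlled by the weighted `L²` norm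
with weight `‖ξ‖ ^ (2 * s)`. -/
theorem exists_setLIntegral_ball_enorm_le {E : Type*} [NormedAddCommGroup E]
    (hn : 1 ≤ Module.finrank ℝ V) {s : ℝ} (hs : 2 * s < Module.finrank ℝ V) :
    ∃ K : ℝ, 0 < K ∧ ∀ F : V → E, AEStronglyMeasurable F → ∀ N : ℝ, 0 ≤ N →
      ∫⁻ ξ, ENNReal.ofReal (‖ξ‖ ^ (2 * s) * ‖F ξ‖ ^ 2) ≤ ENNReal.ofReal (N ^ 2) →
      ∀ R : ℝ, 0 < R → ∫⁻ ξ in ball 0 R, ‖F ξ‖ₑ ≤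
        ENNReal.ofReal (K * R ^ (Module.finrank ℝ V / 2 - s) * N) := by
  have : Nontrivial V := Module.nontrivial_of_finrank_pos (R := ℝ) hn
  set J : ℝ := ∫ x in ball (0 : V) 1, ‖x‖ ^ (-(2 * s))
  have hJ : 0 ≤ J := integral_nonneg fun _ ↦ by positivity
  refine ⟨√(J + 1), by positivity, fun F hF N hN hI R hR ↦ ?_⟩
  have hweight : ∫⁻ x in ball (0 : V) R, ENNReal.ofReal (‖x‖ ^ (-s)) ^ (2 : ℝ) ≤
      ENNReal.ofReal ((√(J + 1) * R ^ (Module.finrank ℝ V / 2 - s)) ^ 2) := by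
    calc _ = ∫⁻ x in ball (0 : V) R, ENNReal.ofReal (‖x‖ ^ (-(2 * s))) := by
          refine lintegral_congr fun x ↦ ?_
          rw [ENNReal.ofReal_rpow_of_nonneg (by positivity) zero_le_two,
            ← Real.rpow_mul (norm_nonneg _)]
          ring_nf
      _ = ENNReal.ofReal (R ^ (Module.finrank ℝ V + -(2 * s)) * J) := by
          rw [← setIntegral_ball_norm_rpow _ hR, ofReal_integral_eq_lintegral_ofReal
            (integrableOn_ball_norm_rpow hn (by linarith) R) (.of_forall fun _ ↦ by positivity)]
      _ ≤ _ := by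
          refine ENNReal.ofReal_le_ofReal ?_
          rw [mul_pow, Real.sq_sqrt (by positivity), ← Real.rpow_mul_natCast hR.le, mul_comm]
          refine mul_le_mul (by linarith) (le_of_eq ?_) (by positivity) (by positivity)
          push_cast
          ring_nf
  have hpart : ∫⁻ x in ball (0 : V) R, ENNReal.ofReal (‖x‖ ^ s * ‖F x‖) ^ (2 : ℝ) ≤
      ENNReal.ofReal (N ^ 2) := by
    refine (setLIntegral_le_lintegral _ _).trans (le_of_eq_of_le ?_ hI)
    refine lintegral_congr fun x ↦ ?_
    rw [ENNReal.rpow_two, ← ENNReal.ofReal_pow (by positivity), mul_pow,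
      ← Real.rpow_mul_natCast (norm_nonneg _)]
    push_cast
    ring_nf
  have hroot (a : ℝ) (ha : 0 ≤ a) :
      ENNReal.ofReal (a ^ 2) ^ (1 / (2 : ℝ)) = ENNReal.ofReal a := by
    rw [ENNReal.ofReal_rpow_of_nonneg (by positivity) (by norm_num), ← Real.sqrt_eq_rpow,
      Real.sqrt_sq ha]
  calc ∫⁻ ξ in ball 0 R, ‖F ξ‖ₑ
      = ∫⁻ ξ in ball 0 R, ((fun ξ : V ↦ ENNReal.ofReal (‖ξ‖ ^ (-s))) *
          fun ξ : V ↦ ENNReal.ofReal (‖ξ‖ ^ s * ‖F ξ‖)) ξ := by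
        refine lintegral_congr_ae (ae_restrict_of_ae ?_)
        filter_upwards [Measure.ae_ne volume (0 : V)] with ξ hξ
        have hξ' : 0 < ‖ξ‖ := norm_pos_iff.mpr hξ
        rw [Pi.mul_apply, ← ENNReal.ofReal_mul (by positivity), ← mul_assoc,
          ← Real.rpow_add hξ', neg_add_cancel, Real.rpow_zero, one_mul, ofReal_norm]
    _ ≤ _ := ENNReal.lintegral_mul_le_Lp_mul_Lq _ Real.HolderConjugate.two_two
        (by fun_prop)
        ((by fun_prop : AEMeasurable fun ξ : V ↦ ‖ξ‖ ^ s).mul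
          hF.norm.aemeasurable).ennreal_ofReal.restrict
    _ ≤ ENNReal.ofReal ((√(J + 1) * R ^ (Module.finrank ℝ V / 2 - s)) ^ 2) ^ (1 / (2 : ℝ)) *
          ENNReal.ofReal (N ^ 2) ^ (1 / (2 : ℝ)) := by
        gcongr
    _ = _ := by
        rw [hroot _ (by positivity), hroot _ hN, ← ENNReal.ofReal_mul (by positivity)]

/-- Smooth decomposition of a Schwartz function into low and high frequencies. -/
theorem exists_eq_add_lowFrequency_highFrequency (f : SchwartzMap V H) {A : ℝ} (hA : 0 < A) :
    ∃ g h : SchwartzMap V H, f = g + h ∧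
      (∀ x, ‖g x‖ₑ ≤ ∫⁻ ξ in ball 0 (2 * A), ‖𝓕 f ξ‖ₑ) ∧
      ∫⁻ x, ‖h x‖ₑ ^ 2 ≤ ∫⁻ ξ in {ξ | A ≤ ‖ξ‖}, ‖𝓕 f ξ‖ₑ ^ 2 := by
  let χ : ContDiffBump (0 : V) := ⟨A, 2 * A, hA, by linarith⟩
  have hχ : (χ : V → ℝ).HasTemperateGrowth := χ.hasCompactSupport.hasTemperateGrowth χ.contDiff
  let G : SchwartzMap V H := smulLeftCLM H χ (𝓕 f)
  have hG (ξ : V) : G ξ = χ ξ • 𝓕 f ξ := smulLeftCLM_apply_apply hχ _ _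
  refine ⟨𝓕⁻ G, f - 𝓕⁻ G, by abel, fun x ↦ ?_, ?_⟩
  · rw [fourierInv_coe, Real.fourierInv_eq]
    refine (enorm_integral_le_lintegral_enorm _).trans ?_
    rw [← lintegral_indicator measurableSet_ball]
    refine lintegral_mono fun ξ ↦ ?_
    rw [hG, Circle.smul_def, enorm_smul, enorm_smul, ← ofReal_norm, Circle.norm_coe,
      ENNReal.ofReal_one, one_mul]
    by_cases hξ : ξ ∈ ball 0 (2 * A)
    · rw [Set.indicator_of_mem hξ]
      refine mul_le_of_le_one_left' ?_
      rw [Real.enorm_of_nonneg χ.nonneg]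
      exact ENNReal.ofReal_le_one.mpr χ.le_one
    · rw [χ.zero_of_le_dist (by simpa using hξ)]
      simp
  · rw [← lintegral_enorm_sq_fourier, ← lintegral_indicator
      (measurableSet_le measurable_const measurable_norm)]
    refine lintegral_mono fun ξ ↦ ?_
    have hsub : 𝓕 (f - 𝓕⁻ G) ξ = (1 - χ ξ) • 𝓕 f ξ := by
      rw [sub_eq_add_neg, FourierTransform.fourier_add, FourierTransform.fourier_neg,
        FourierTransform.fourier_fourierInv_eq, ← sub_eq_add_neg, sub_apply, hG, sub_smul,
        one_smul]
    rw [hsub]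
    by_cases hξ : A ≤ ‖ξ‖
    · rw [Set.indicator_of_mem (show ξ ∈ {ξ : V | A ≤ ‖ξ‖} from hξ), enorm_smul]
      gcongr
      refine mul_le_of_le_one_left' ?_
      rw [Real.enorm_of_nonneg (sub_nonneg.mpr χ.le_one)]
      exact ENNReal.ofReal_le_one.mpr (by linarith [χ.nonneg (x := ξ)])
    · rw [χ.one_of_mem_closedBall (by simpa using (not_le.mp hξ).le)]
      simp

/-- Chebyshev's inequality for the high-frequency part bounds the distribution function at
a level at which the low-frequency part is negligible. -/
theorem meas_norm_ge_le_of_setLIntegral_ball_le (f : SchwartzMap V H) {A t : ℝ} (hA : 0 < A)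
    (ht : 0 < t) (hlow : ∫⁻ ξ in ball 0 (2 * A), ‖𝓕 f ξ‖ₑ ≤ ENNReal.ofReal (t / 2)) :
    volume {x | t ≤ ‖f x‖} ≤
      ENNReal.ofReal (4 / t ^ 2) * ∫⁻ ξ in {ξ | A ≤ ‖ξ‖}, ‖𝓕 f ξ‖ₑ ^ 2 := by
  obtain ⟨g, h, rfl, hg, hh⟩ := exists_eq_add_lowFrequency_highFrequency f hA
  have hsub : {x | t ≤ ‖(g + h) x‖} ⊆ {x | ENNReal.ofReal (t ^ 2 / 4) ≤ ‖h x‖ₑ ^ 2} := by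
    intro x (hx : t ≤ ‖(g + h) x‖)
    have hgx : ‖g x‖ ≤ t / 2 := by
      rw [← ENNReal.ofReal_le_ofReal_iff (by positivity), ofReal_norm]
      exact (hg x).trans hlow
    have hhx : t / 2 ≤ ‖h x‖ := by
      have := norm_add_le (g x) (h x)
      rw [add_apply] at hx
      linarith
    rw [Set.mem_ofPred_eq, ← ofReal_norm, ← ENNReal.ofReal_pow (norm_nonneg _)]
    refine ENNReal.ofReal_le_ofReal ?_
    calc t ^ 2 / 4 = (t / 2) ^ 2 := by ring
      _ ≤ ‖h x‖ ^ 2 := by gcongr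
  have h0 : (0 : ℝ) < t ^ 2 / 4 := by positivity
  refine (measure_mono hsub).trans ((meas_ge_le_lintegral_div
    (by have := h.continuous; fun_prop) (by simpa using h0) ENNReal.ofReal_ne_top).trans ?_)
  rw [ENNReal.div_eq_inv_mul, ← ENNReal.ofReal_inv_of_pos h0, inv_div]
  gcongr

/-- The homogeneous Sobolev inequality, before normalisation: `N` is an upper bound for the
homogeneous Sobolev norm. -/
theorem exists_lintegral_norm_rpow_le (hn : 1 ≤ Module.finrank ℝ V) {s p q : ℝ} (hq : 0 < q)
    (hs : 2 * s < Module.finrank ℝ V) (hp : p = q + 2)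
    (hqs : (Module.finrank ℝ V / 2 - s) * q = 2 * s) :
    ∃ M : ℝ, 0 < M ∧ ∀ f : SchwartzMap V H, ∀ N : ℝ, 0 < N →
      ∫⁻ ξ, ENNReal.ofReal (‖ξ‖ ^ (2 * s) * ‖𝓕 f ξ‖ ^ 2) ≤ ENNReal.ofReal (N ^ 2) →
      ∫⁻ x, ENNReal.ofReal (‖f x‖ ^ p) ≤ ENNReal.ofReal (M * N ^ q) *
        ∫⁻ ξ, ENNReal.ofReal (‖ξ‖ ^ (2 * s) * ‖𝓕 f ξ‖ ^ 2) := by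
  obtain ⟨K, hK, hball⟩ := exists_setLIntegral_ball_enorm_le (E := H) hn hs
  set β : ℝ := Module.finrank ℝ V / 2 - s with hβ_def
  have hβ : 0 < β := by linarith
  have hp0 : 0 < p := by linarith
  refine ⟨p * 4 / q * (2 * K * 2 ^ β) ^ q, by positivity, fun f N hN hI ↦ ?_⟩
  have hFcont := (𝓕 f).continuous
  let L : V → ℝ := fun ξ ↦ 2 * K * N * (2 * ‖ξ‖) ^ β
  have hL : Measurable L := by fun_prop
  let μ : Measure V := volume.withDensity fun ξ ↦ ‖𝓕 f ξ‖ₑ ^ 2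
  have hdist (t : ℝ) (ht : 0 < t) :
      volume {x | t ≤ ‖f x‖} ≤ ENNReal.ofReal (4 / t ^ 2) * μ {ξ | t ≤ L ξ} := by
    set A : ℝ := (t / (2 * K * N)) ^ β⁻¹ / 2
    have hA : 0 < A := by positivity
    have hAβ : (2 * A) ^ β = t / (2 * K * N) := by
      rw [mul_div_cancel₀ _ two_ne_zero, Real.rpow_inv_rpow (by positivity) hβ.ne']
    refine (meas_norm_ge_le_of_setLIntegral_ball_le f hA ht ?_).trans ?_
    · refine (hball _ hFcont.aestronglyMeasurable N hN.le hI _ (by positivity)).trans_eq ?_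
      rw [hAβ]
      congr 1
      field_simp
    · rw [withDensity_apply _ (measurableSet_le measurable_const hL)]
      gcongr ENNReal.ofReal _ * ?_
      refine lintegral_mono_set fun ξ (hξ : A ≤ ‖ξ‖) ↦ ?_
      change t ≤ L ξ
      calc t = 2 * K * N * (2 * A) ^ β := by rw [hAβ]; field_simp
        _ ≤ 2 * K * N * (2 * ‖ξ‖) ^ β := by gcongr
  have hμ : ∫⁻ ξ, ENNReal.ofReal (L ξ ^ q) ∂μ =
      ENNReal.ofReal ((2 * K * 2 ^ β) ^ q * N ^ q) *
        ∫⁻ ξ, ENNReal.ofReal (‖ξ‖ ^ (2 * s) * ‖𝓕 f ξ‖ ^ 2) := by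
    rw [lintegral_withDensity_eq_lintegral_mul₀ (by fun_prop) (by fun_prop),
      ← lintegral_const_mul' _ _ ENNReal.ofReal_ne_top]
    refine lintegral_congr fun ξ ↦ ?_
    rw [Pi.mul_apply, ← ofReal_norm, ← ENNReal.ofReal_pow (norm_nonneg _),
      ← ENNReal.ofReal_mul (by positivity), ← ENNReal.ofReal_mul (by positivity)]
    have : L ξ = 2 * K * 2 ^ β * N * ‖ξ‖ ^ β := by
      simp only [L]
      rw [Real.mul_rpow zero_le_two (norm_nonneg _)]
      ring
    rw [this, Real.mul_rpow (by positivity) (by positivity),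
      Real.mul_rpow (by positivity) (by positivity), ← Real.rpow_mul (norm_nonneg _), hqs]
    ring_nf
  calc ∫⁻ x, ENNReal.ofReal (‖f x‖ ^ p)
      = ENNReal.ofReal p *
          ∫⁻ t in Set.Ioi 0, volume {x | t ≤ ‖f x‖} * ENNReal.ofReal (t ^ (p - 1)) :=
        lintegral_rpow_eq_lintegral_meas_le_mul _ (.of_forall fun _ ↦ norm_nonneg _)
          f.continuous.norm.aemeasurable hp0
    _ ≤ ENNReal.ofReal p *
          ∫⁻ t in Set.Ioi 0,
            ENNReal.ofReal 4 * (μ {ξ | t ≤ L ξ} * ENNReal.ofReal (t ^ (q - 1))) := by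
        gcongr ENNReal.ofReal p * ?_
        refine setLIntegral_mono' measurableSet_Ioi fun t (ht : 0 < t) ↦ ?_
        grw [hdist t ht]
        rw [mul_right_comm, ← ENNReal.ofReal_mul (by positivity), mul_left_comm (ENNReal.ofReal 4),
          ← ENNReal.ofReal_mul (by positivity), mul_comm]
        apply le_of_eq
        congr 2
        rw [show p - 1 = (q - 1) + 2 by linarith, Real.rpow_add ht, Real.rpow_two]
        field_simp
    _ = ENNReal.ofReal (p * 4 / q) * ∫⁻ ξ, ENNReal.ofReal (L ξ ^ q) ∂μ := by
        rw [lintegral_const_mul' _ _ ENNReal.ofReal_ne_top,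
          lintegral_rpow_eq_lintegral_meas_le_mul μ
            (.of_forall fun ξ ↦ by simp only [L, Pi.zero_apply]; positivity) hL.aemeasurable hq,
          ← mul_assoc, ← mul_assoc, ← ENNReal.ofReal_mul (by positivity),
          ← ENNReal.ofReal_mul (by positivity), div_mul_cancel₀ _ hq.ne']
    _ = _ := by
        rw [hμ, ← mul_assoc, ← ENNReal.ofReal_mul (by positivity), mul_assoc _ _ (N ^ q)]

end HomogeneousSobolev

/-- Sobolev-type embedding of the homogeneous Sobolev space
`Ẇ^{s,2}(ℝ^d)` into `L^{2d/(d−2s)}(ℝ^d)`: for `0 ≤ s < d/2` there is a constant `C > 0`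
such that `‖f‖_{L^{2d/(d−2s)}} ≤ C (∫ ‖ξ‖^{2s} |𝓕f(ξ)|² dξ)^{1/2}` for all Schwartz `f`. -/
theorem homogeneous_sobolev_embedding_pos
    (d : ℕ) (hd : 1 ≤ d) (s : ℝ) (hs : 0 ≤ s) (hsd : s < d / 2) :
    ∃ C : ℝ, 0 < C ∧
      ∀ f : SchwartzMap (EuclideanSpace ℝ (Fin d)) ℂ,
        eLpNorm (⇑f) (ENNReal.ofReal (2 * d / (d - 2 * s))) volume ≤
          ENNReal.ofReal C *
            (∫⁻ ξ : EuclideanSpace ℝ (Fin d),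
              ENNReal.ofReal (‖ξ‖ ^ (2 * s) * ‖𝓕 (⇑f) ξ‖ ^ 2)) ^ ((1 : ℝ) / 2) := by
  have hd0 : (0 : ℝ) < d := by exact_mod_cast hd
  have hden : 0 < d - 2 * s := by linarith
  set p : ℝ := 2 * d / (d - 2 * s) with hp_def
  have hp : 0 < p := by positivity
  have hLp (f : SchwartzMap (EuclideanSpace ℝ (Fin d)) ℂ) :
      eLpNorm f (ENNReal.ofReal p) volume = (∫⁻ x, ENNReal.ofReal (‖f x‖ ^ p)) ^ (1 / p) := by
    rw [eLpNorm_eq_lintegral_rpow_enorm_toReal (by simpa using hp) ENNReal.ofReal_ne_top,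
      ENNReal.toReal_ofReal hp.le]
    congr 1
    refine lintegral_congr fun x ↦ ?_
    rw [← ofReal_norm, ENNReal.ofReal_rpow_of_nonneg (norm_nonneg _) hp.le]
  rcases hs.eq_or_lt with rfl | hs
  · refine ⟨1, one_pos, fun f ↦ ?_⟩
    have hp2 : p = 2 := by rw [hp_def]; field_simp; ring
    have hsq (g : SchwartzMap (EuclideanSpace ℝ (Fin d)) ℂ) (x : EuclideanSpace ℝ (Fin d)) :
        ENNReal.ofReal (‖g x‖ ^ 2) = ‖g x‖ₑ ^ 2 := by
      rw [ENNReal.ofReal_pow (norm_nonneg _), ofReal_norm]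
    rw [hLp, hp2, ENNReal.ofReal_one, one_mul]
    simp only [mul_zero, Real.rpow_zero, one_mul, Real.rpow_two, ← fourier_coe, hsq,
      lintegral_enorm_sq_fourier, le_refl]
  have hq : 0 < p - 2 := by
    rw [hp_def, sub_pos, lt_div_iff₀ hden]
    linarith
  obtain ⟨M, hM, hbound⟩ := exists_lintegral_norm_rpow_le (V := EuclideanSpace ℝ (Fin d))
    (H := ℂ) (s := s) (p := p) (by simpa using hd) hq (by simpa using by linarith) (by ring)
    (by rw [hp_def, finrank_euclideanSpace_fin]; field_simp; ring)
  refine ⟨M ^ (1 / p), by positivity, fun f ↦ ?_⟩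
  have hb := hbound f
  rw [hLp, ← fourier_coe]
  generalize ∫⁻ ξ, ENNReal.ofReal (‖ξ‖ ^ (2 * s) * ‖𝓕 f ξ‖ ^ 2) = I at hb ⊢
  rcases eq_or_ne I ⊤ with rfl | hI
  · have hM' : ENNReal.ofReal (M ^ (1 / p)) ≠ 0 := by
      simpa using Real.rpow_pos_of_pos hM (1 / p)
    rw [ENNReal.top_rpow_of_pos (by norm_num), ENNReal.mul_top hM']
    exact le_top
  rcases eq_or_ne I 0 with rfl | hI0
  · have h0 := hb 1 one_pos (zero_le)
    rw [mul_zero, nonpos_iff_eq_zero] at h0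
    rw [h0, ENNReal.zero_rpow_of_pos (by positivity)]
    exact zero_le
  lift I to NNReal using hI
  have hIpos : 0 < (I : ℝ) := by exact_mod_cast pos_iff_ne_zero.mpr hI0
  rw [← ENNReal.ofReal_coe_nnreal] at hb ⊢
  have h := hb √I (by positivity) (by rw [Real.sq_sqrt hIpos.le])
  refine (ENNReal.rpow_le_rpow h (by positivity)).trans_eq ?_
  rw [← ENNReal.ofReal_mul (by positivity),
    ENNReal.ofReal_rpow_of_nonneg (by positivity) (by positivity),
    ENNReal.ofReal_rpow_of_nonneg hIpos.le (by positivity), ← ENNReal.ofReal_mul (by positivity),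
    mul_assoc, Real.mul_rpow hM.le (by positivity), Real.sqrt_eq_rpow, ← Real.rpow_mul hIpos.le,
    ← Real.rpow_add_one hIpos.ne', ← Real.rpow_mul hIpos.le]
  congr 3
  field_simp
  ring
end

section
/- Let d ∈ ℕ, d ≥ 1, let λ_1,…,λ_d > 0, and let Q = ∏_{j=1}^d [0, λ_j) be a non-degenerate rectangular box in ℝ^d. Then for every s ∈ ℝ the integral ∫_{ℝ^d} ‖x‖^{2s} |𝓕(1_Q)(x)|² dx is finite if and only if −d/2 < s < 1/2. -/
open MeasureTheory
open scoped FourierTransform ENNReal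

/-- The power spectrum `|𝓕(1_[0, l))|²` of an interval of length `l`. -/
noncomputable def intervalSpectrum (l t : ℝ) : ℝ := (l * Real.sinc (Real.pi * l * t)) ^ 2

lemma intervalSpectrum_nonneg (l t : ℝ) : 0 ≤ intervalSpectrum l t := sq_nonneg _

@[fun_prop]
lemma continuous_intervalSpectrum (l : ℝ) : Continuous (intervalSpectrum l) := by
  have := Real.continuous_sinc
  unfold intervalSpectrum
  fun_prop

lemma intervalSpectrum_abs (l t : ℝ) : intervalSpectrum l |t| = intervalSpectrum l t := by
  rcases abs_choice t with h | h <;> rw [h]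
  simp [intervalSpectrum, Real.sinc_neg]

lemma intervalSpectrum_le_sq (l t : ℝ) : intervalSpectrum l t ≤ l ^ 2 := by
  have h : Real.sinc (Real.pi * l * t) ^ 2 ≤ 1 :=
    (sq_le_one_iff_abs_le_one _).2 (Real.abs_sinc_le_one _)
  rw [intervalSpectrum, mul_pow]
  exact mul_le_of_le_one_right (sq_nonneg _) h

lemma intervalSpectrum_eq {l t : ℝ} (hl : 0 < l) (ht : t ≠ 0) :
    intervalSpectrum l t = (Real.pi ^ 2)⁻¹ * (Real.sin (Real.pi * l * t) ^ 2 / t ^ 2) := by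
  rw [intervalSpectrum, Real.sinc_of_ne_zero (by positivity)]
  field_simp

lemma intervalSpectrum_le_inv_sq {l t : ℝ} (hl : 0 < l) (ht : t ≠ 0) :
    intervalSpectrum l t ≤ (t ^ 2)⁻¹ := by
  rw [intervalSpectrum_eq hl ht, div_eq_mul_inv, ← mul_assoc]
  refine mul_le_of_le_one_left (by positivity)
    (mul_le_one₀ ?_ (by positivity) (Real.sin_sq_le_one _))
  exact inv_le_one_of_one_le₀ (one_le_pow₀ (by linarith [Real.pi_gt_three]))

lemma norm_integral_Ico_exp {l : ℝ} (hl : 0 < l) (t : ℝ) :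
    ‖∫ u in Set.Ico 0 l, Complex.exp (((-2 * Real.pi * (u * t) : ℝ) : ℂ) * Complex.I)‖ ^ 2 =
      intervalSpectrum l t := by
  rw [setIntegral_congr_set Ico_ae_eq_Ioc, ← intervalIntegral.integral_of_le hl.le]
  rcases eq_or_ne t 0 with rfl | ht
  · simp [intervalSpectrum]
  have hc : ((-2 * Real.pi * t : ℝ) : ℂ) * Complex.I ≠ 0 := by
    simp [ht, Real.pi_ne_zero]
  have h := integral_exp_mul_complex (a := 0) (b := l) hc
  have e : ∀ u : ℝ, ((-2 * Real.pi * (u * t) : ℝ) : ℂ) * Complex.I =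
      ((-2 * Real.pi * t : ℝ) : ℂ) * Complex.I * u := by
    intro u; push_cast; ring
  simp_rw [e]
  rw [h, norm_div]
  have e2 : ((-2 * Real.pi * t : ℝ) : ℂ) * Complex.I * l =
      Complex.I * ((-2 * Real.pi * t * l : ℝ) : ℂ) := by
    push_cast; ring
  rw [e2, Complex.ofReal_zero, mul_zero, Complex.exp_zero, Complex.norm_exp_I_mul_ofReal_sub_one,
    norm_mul (_ : ℂ) Complex.I, Complex.norm_I, Complex.norm_real, intervalSpectrum_eq hl ht,
    div_pow]
  rw [mul_one, Real.norm_eq_abs, Real.norm_eq_abs, sq_abs, sq_abs,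
    show -2 * Real.pi * t * l / 2 = -(Real.pi * l * t) by ring, Real.sin_neg]
  field_simp

lemma integrable_abs_rpow_mul_intervalSpectrum {a l : ℝ} (hl : 0 < l) (ha : -1 < a) (ha' : a < 1) :
    Integrable fun t : ℝ => |t| ^ a * intervalSpectrum l t := by
  have key := (integrable_fun_norm_addHaar (E := ℝ) volume
    (f := fun y : ℝ => y ^ a * intervalSpectrum l y)).2 ?_
  · simpa only [Real.norm_eq_abs, intervalSpectrum_abs] using key
  have hm : Measurable fun y : ℝ => y ^ a * intervalSpectrum l y := by fun_prop
  simp only [Module.finrank_self, Nat.sub_self, pow_zero, one_smul]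
  rw [← Set.Ioo_union_Ici_eq_Ioi zero_lt_one]
  refine IntegrableOn.union ?_ ((integrableOn_Ici_iff_integrableOn_Ioi (by finiteness)).2 ?_)
  · refine Integrable.mono'
      (((intervalIntegral.integrableOn_Ioo_rpow_iff zero_lt_one).2 ha).mul_const (l ^ 2))
      hm.aestronglyMeasurable ?_
    filter_upwards [self_mem_ae_restrict measurableSet_Ioo] with y hy
    have hy0 : 0 ≤ y ^ a := Real.rpow_nonneg hy.1.le _
    rw [Real.norm_of_nonneg (mul_nonneg hy0 (intervalSpectrum_nonneg _ _))]
    exact mul_le_mul_of_nonneg_left (intervalSpectrum_le_sq _ _) hy0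
  · refine Integrable.mono' (integrableOn_Ioi_rpow_of_lt (a := a - 2) (by linarith) zero_lt_one)
      hm.aestronglyMeasurable ?_
    filter_upwards [self_mem_ae_restrict measurableSet_Ioi] with y hy
    have hy1 : 0 < y := zero_lt_one.trans hy
    have hy0 : 0 ≤ y ^ a := Real.rpow_nonneg hy1.le _
    rw [Real.norm_of_nonneg (mul_nonneg hy0 (intervalSpectrum_nonneg _ _)), Real.rpow_sub hy1,
      div_eq_mul_inv, Real.rpow_two]
    exact mul_le_mul_of_nonneg_left (intervalSpectrum_le_inv_sq hl hy1.ne') hy0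

lemma lintegral_Ioi_sin_sq_div {c : ℝ} (hc : 0 < c) :
    ∫⁻ t in Set.Ioi 1, ENNReal.ofReal (Real.sin (c * t) ^ 2 / t) = ⊤ := by
  by_contra hfin
  set f : ℝ → ℝ≥0∞ := fun t => ENNReal.ofReal (Real.sin (c * t) ^ 2 / t) with hf
  have hfm : Measurable f := by fun_prop
  set h : ℝ := Real.pi / 2 / c with hh
  have hpos : 0 < h := by positivity
  have hshift : ∫⁻ t in Set.Ioi 1, f (t + h) ≤ ∫⁻ t in Set.Ioi 1, f t := by
    rw [← lintegral_indicator measurableSet_Ioi, ← lintegral_indicator measurableSet_Ioi,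
      ← lintegral_add_right_eq_self (fun t => (Set.Ioi 1).indicator f t) h]
    refine lintegral_mono fun t => ?_
    by_cases ht : t ∈ Set.Ioi (1 : ℝ)
    · have ht' : t + h ∈ Set.Ioi (1 : ℝ) := lt_trans (Set.mem_Ioi.1 ht) (lt_add_of_pos_right t hpos)
      simp only [Set.indicator_of_mem ht, Set.indicator_of_mem ht', le_refl]
    · simp only [Set.indicator_of_notMem ht, zero_le]
  have hbound : ∫⁻ t in Set.Ioi 1, ENNReal.ofReal ((1 + h)⁻¹ * t⁻¹) ≤
      ∫⁻ t in Set.Ioi 1, (f t + f (t + h)) := by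
    refine setLIntegral_mono (by fun_prop) fun t ht => ?_
    have ht1 : 1 < t := ht
    have ht0 : 0 < t := zero_lt_one.trans ht1
    rw [hf]
    simp only
    rw [← ENNReal.ofReal_add (by positivity) (by positivity)]
    refine ENNReal.ofReal_le_ofReal ?_
    have e : c * (t + h) = c * t + Real.pi / 2 := by rw [hh]; field_simp
    rw [e, Real.sin_add_pi_div_two, ← mul_inv]
    calc ((1 + h) * t)⁻¹ ≤ (t + h)⁻¹ := by
          refine inv_anti₀ (by positivity) ?_
          nlinarith
      _ = Real.sin (c * t) ^ 2 / (t + h) + Real.cos (c * t) ^ 2 / (t + h) := by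
          rw [← add_div, Real.sin_sq_add_cos_sq, one_div]
      _ ≤ _ := by
          gcongr
          linarith
  have hlt : ∫⁻ t in Set.Ioi 1, ENNReal.ofReal ((1 + h)⁻¹ * t⁻¹) < ⊤ := by
    refine hbound.trans_lt ?_
    rw [lintegral_add_left hfm]
    exact ENNReal.add_lt_top.2
      ⟨lt_top_iff_ne_top.2 hfin, hshift.trans_lt (lt_top_iff_ne_top.2 hfin)⟩
  have hInt : IntegrableOn (fun t : ℝ => (1 + h)⁻¹ * t⁻¹) (Set.Ioi 1) := by
    refine ⟨by fun_prop, ?_⟩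
    rw [hasFiniteIntegral_iff_ofReal]
    · exact hlt
    filter_upwards [self_mem_ae_restrict measurableSet_Ioi] with y hy
    have : 0 < y := zero_lt_one.trans hy
    simp only [Pi.zero_apply]
    positivity
  have hInt' : IntegrableOn (fun t : ℝ => (1 + h) * ((1 + h)⁻¹ * t⁻¹)) (Set.Ioi 1) :=
    hInt.const_mul (1 + h)
  refine not_integrableOn_Ioi_inv (a := 1) (hInt'.congr_fun ?_ measurableSet_Ioi)
  intro t _
  field_simp

lemma lintegral_abs_rpow_mul_intervalSpectrum_eq_top {a l : ℝ} (hl : 0 < l) (ha : 1 ≤ a) :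
    ∫⁻ t : ℝ, ENNReal.ofReal (|t| ^ a * intervalSpectrum l t) = ⊤ := by
  rw [eq_top_iff]
  have hpi : ENNReal.ofReal (Real.pi ^ 2)⁻¹ ≠ 0 := by
    rw [Ne, ENNReal.ofReal_eq_zero, not_le]; positivity
  calc ⊤ = ENNReal.ofReal (Real.pi ^ 2)⁻¹ *
        ∫⁻ t in Set.Ioi 1, ENNReal.ofReal (Real.sin (Real.pi * l * t) ^ 2 / t) := by
        rw [lintegral_Ioi_sin_sq_div (by positivity), ENNReal.mul_top hpi]
    _ = ∫⁻ t in Set.Ioi 1,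
        ENNReal.ofReal ((Real.pi ^ 2)⁻¹ * (Real.sin (Real.pi * l * t) ^ 2 / t)) := by
        rw [← lintegral_const_mul _ (by fun_prop)]
        simp_rw [ENNReal.ofReal_mul (show 0 ≤ (Real.pi ^ 2)⁻¹ by positivity)]
    _ ≤ ∫⁻ t in Set.Ioi 1, ENNReal.ofReal (|t| ^ a * intervalSpectrum l t) := by
        refine setLIntegral_mono (by fun_prop) fun t ht => ENNReal.ofReal_le_ofReal ?_
        have ht1 : 1 < t := ht
        have ht0 : 0 < t := zero_lt_one.trans ht1
        rw [abs_of_pos ht0]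
        calc _ = t * intervalSpectrum l t := by
              rw [intervalSpectrum_eq hl ht0.ne']; field_simp
          _ ≤ _ := by
              refine mul_le_mul_of_nonneg_right ?_ (intervalSpectrum_nonneg _ _)
              simpa using Real.rpow_le_rpow_of_exponent_le ht1.le ha
    _ ≤ _ := setLIntegral_le_lintegral _ _

lemma lintegral_intervalSpectrum_ne_zero {l : ℝ} (hl : 0 < l) :
    ∫⁻ t : ℝ, ENNReal.ofReal (intervalSpectrum l t) ≠ 0 := by
  have hc : Continuous fun t => ENNReal.ofReal (intervalSpectrum l t) :=
    ENNReal.continuous_ofReal.comp (continuous_intervalSpectrum l)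
  rw [Ne, lintegral_eq_zero_iff hc.measurable, hc.ae_eq_iff_eq volume continuous_zero]
  intro h
  have h0 := congrFun h 0
  simp [intervalSpectrum, hl.ne'] at h0

/-- Tonelli's theorem for a product of functions of one coordinate each. -/
lemma lintegral_fin_prod_eq_prod {n : ℕ} {f : Fin n → ℝ → ℝ≥0∞} (hf : ∀ i, Measurable (f i)) :
    ∫⁻ x : Fin n → ℝ, ∏ i, f i (x i) = ∏ i, ∫⁻ t, f i t := by
  induction n with
  | zero => simp [volume_pi]
  | succ n ih =>
    have hp := (volume_preserving_piFinSuccAbove (fun _ : Fin (n + 1) => ℝ) 0).symm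
    rw [← hp.lintegral_comp_emb (MeasurableEquiv.measurableEmbedding _), Fin.prod_univ_succ,
      ← ih fun i => hf i.succ]
    simp_rw [MeasurableEquiv.piFinSuccAbove_symm_apply, Fin.insertNthEquiv,
      Fin.prod_univ_succ, Fin.insertNth_zero]
    simp only [Equiv.coe_fn_mk, Fin.cons_succ, Fin.cons_zero]
    exact lintegral_prod_mul (hf 0).aemeasurable
      (Finset.measurable_fun_prod _ fun (i : Fin n) _ =>
        (hf i.succ).comp (measurable_pi_apply i)).aemeasurable

lemma lintegral_euclideanSpace_prod_eq_prod {n : ℕ} {f : Fin n → ℝ → ℝ≥0∞}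
    (hf : ∀ i, Measurable (f i)) :
    ∫⁻ x : EuclideanSpace ℝ (Fin n), ∏ i, f i (x i) = ∏ i, ∫⁻ t, f i t := by
  rw [← lintegral_fin_prod_eq_prod hf]
  exact (EuclideanSpace.volume_preserving_symm_measurableEquiv_toLp (Fin n)).lintegral_comp_emb
    (MeasurableEquiv.measurableEmbedding _) fun y => ∏ i, f i (y i)

lemma ae_forall_coord_ne_zero (d : ℕ) :
    ∀ᵐ x : EuclideanSpace ℝ (Fin d), ∀ j, x j ≠ 0 := by
  refine ae_all_iff.2 fun j => ?_
  have h1 : Measure.QuasiMeasurePreserving (fun x : Fin d → ℝ => x j) volume volume :=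
    Measure.quasiMeasurePreserving_eval (fun _ => volume) j
  have h2 := h1.comp (PiLp.volume_preserving_ofLp (Fin d)).quasiMeasurePreserving
  exact h2.ae (Measure.ae_ne volume 0)

/-- The box `∏ [0, lam j)` in Euclidean space. -/
def euclideanBox {d : ℕ} (lam : Fin d → ℝ) : Set (EuclideanSpace ℝ (Fin d)) :=
  {x | ∀ j, x j ∈ Set.Ico 0 (lam j)}

lemma fourier_indicator_euclideanBox {d : ℕ} (lam : Fin d → ℝ) (x : EuclideanSpace ℝ (Fin d)) :
    𝓕 (Set.indicator (euclideanBox lam) fun _ => (1 : ℂ)) x =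
      ∏ j, ∫ u in Set.Ico 0 (lam j),
        Complex.exp (((-2 * Real.pi * (u * x j) : ℝ) : ℂ) * Complex.I) := by
  simp_rw [← integral_indicator measurableSet_Ico]
  rw [← integral_fintype_prod_volume_eq_prod, Real.fourier_eq',
    ← (EuclideanSpace.volume_preserving_symm_measurableEquiv_toLp (Fin d)).integral_comp'
      (fun v : Fin d → ℝ => ∏ j, (Set.Ico 0 (lam j)).indicator
        (fun u => Complex.exp (((-2 * Real.pi * (u * x j) : ℝ) : ℂ) * Complex.I)) (v j))]
  refine integral_congr_ae (.of_forall fun v => ?_)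
  simp only [MeasurableEquiv.coe_toLp_symm, smul_eq_mul]
  by_cases hv : v ∈ euclideanBox lam
  · rw [Set.indicator_of_mem hv, Finset.prod_congr rfl fun j _ => Set.indicator_of_mem (hv j) _,
      ← Complex.exp_sum, mul_one, ← Finset.sum_mul, ← Complex.ofReal_sum, ← Finset.mul_sum]
    simp [PiLp.inner_apply, mul_comm]
  · rw [Set.indicator_of_notMem hv, mul_zero]
    obtain ⟨j, hj⟩ := not_forall.1 hv
    exact (Finset.prod_eq_zero (Finset.mem_univ j) (Set.indicator_of_notMem hj _)).symm

lemma norm_sq_fourier_indicator_euclideanBox {d : ℕ} {lam : Fin d → ℝ} (hlam : ∀ j, 0 < lam j)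
    (x : EuclideanSpace ℝ (Fin d)) :
    ‖𝓕 (Set.indicator (euclideanBox lam) fun _ => (1 : ℂ)) x‖ ^ 2 =
      ∏ j, intervalSpectrum (lam j) (x j) := by
  rw [fourier_indicator_euclideanBox, norm_prod, ← Finset.prod_pow]
  exact Finset.prod_congr rfl fun j _ => norm_integral_Ico_exp (hlam j) _

lemma lintegral_prod_rpow_mul_intervalSpectrum {d : ℕ} (lam a : Fin d → ℝ) :
    ∫⁻ x : EuclideanSpace ℝ (Fin d),
        ENNReal.ofReal ((∏ j, |x j| ^ a j) * ∏ j, intervalSpectrum (lam j) (x j)) =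
      ∏ j, ∫⁻ t : ℝ, ENNReal.ofReal (|t| ^ a j * intervalSpectrum (lam j) t) := by
  rw [← lintegral_euclideanSpace_prod_eq_prod fun j => by fun_prop]
  refine lintegral_congr fun x => ?_
  rw [← Finset.prod_mul_distrib, ENNReal.ofReal_prod_of_nonneg]
  exact fun j _ => mul_nonneg (by positivity) (intervalSpectrum_nonneg _ _)

lemma lintegral_prod_rpow_mul_intervalSpectrum_lt_top {d : ℕ} {lam a : Fin d → ℝ}
    (hlam : ∀ j, 0 < lam j) (ha : ∀ j, -1 < a j) (ha' : ∀ j, a j < 1) :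
    ∫⁻ x : EuclideanSpace ℝ (Fin d),
        ENNReal.ofReal ((∏ j, |x j| ^ a j) * ∏ j, intervalSpectrum (lam j) (x j)) < ⊤ := by
  rw [lintegral_prod_rpow_mul_intervalSpectrum]
  refine ENNReal.prod_lt_top fun j _ => ?_
  exact (integrable_abs_rpow_mul_intervalSpectrum (hlam j) (ha j) (ha' j)).lintegral_lt_top

lemma prod_abs_rpow_single {d : ℕ} (i : Fin d) (a : ℝ) (x : EuclideanSpace ℝ (Fin d)) :
    ∏ j, |x j| ^ (Pi.single i a : Fin d → ℝ) j = |x i| ^ a := by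
  rw [Finset.prod_eq_single i] <;> simp +contextual [Pi.single_eq_of_ne]

lemma exists_norm_le_sqrt_mul_abs {d : ℕ} (hd : 1 ≤ d) (x : EuclideanSpace ℝ (Fin d)) :
    ∃ i, ‖x‖ ≤ √d * |x i| := by
  have : Nonempty (Fin d) := ⟨⟨0, hd⟩⟩
  obtain ⟨i, hi⟩ := Finite.exists_max fun j => |x j|
  refine ⟨i, ?_⟩
  rw [EuclideanSpace.norm_eq, ← Real.sqrt_sq (abs_nonneg (x i)), ← Real.sqrt_mul (by positivity)]
  refine Real.sqrt_le_sqrt ?_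
  calc ∑ j, ‖x j‖ ^ 2 ≤ ∑ _j : Fin d, |x i| ^ 2 :=
        Finset.sum_le_sum fun j _ => pow_le_pow_left₀ (norm_nonneg _) (hi j) 2
    _ = _ := by simp

section

variable {d : ℕ} {lam : Fin d → ℝ} {s : ℝ}

lemma lintegral_norm_rpow_mul_spectrum_lt_top_of_nonneg (hd : 1 ≤ d) (hlam : ∀ j, 0 < lam j)
    (hs : 0 ≤ s) (hs' : s < 1 / 2) :
    ∫⁻ x : EuclideanSpace ℝ (Fin d),
      ENNReal.ofReal (‖x‖ ^ (2 * s) * ∏ j, intervalSpectrum (lam j) (x j)) < ⊤ := by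
  have hG (x : EuclideanSpace ℝ (Fin d)) : 0 ≤ ∏ j, intervalSpectrum (lam j) (x j) :=
    Finset.prod_nonneg fun j _ => intervalSpectrum_nonneg _ _
  calc _ ≤ ∫⁻ x : EuclideanSpace ℝ (Fin d), ENNReal.ofReal (√d ^ (2 * s)) *
        ∑ i, ENNReal.ofReal ((∏ j, |x j| ^ (Pi.single i (2 * s) : Fin d → ℝ) j) *
          ∏ j, intervalSpectrum (lam j) (x j)) := by
        refine lintegral_mono fun x => ?_
        obtain ⟨i, hi⟩ := exists_norm_le_sqrt_mul_abs hd x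
        refine le_trans ?_ (mul_le_mul_right (Finset.single_le_sum (fun _ _ => zero_le)
          (Finset.mem_univ i)) _)
        rw [prod_abs_rpow_single, ← ENNReal.ofReal_mul (by positivity), ← mul_assoc,
          ← Real.mul_rpow (by positivity) (by positivity)]
        exact ENNReal.ofReal_le_ofReal (mul_le_mul_of_nonneg_right
          (Real.rpow_le_rpow (norm_nonneg _) hi (by positivity)) (hG x))
    _ < ⊤ := by
        rw [lintegral_const_mul _ (by fun_prop), lintegral_finsetSum _ fun i _ => by fun_prop]
        refine ENNReal.mul_lt_top ENNReal.ofReal_lt_top (ENNReal.sum_lt_top.2 fun i _ => ?_)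
        refine lintegral_prod_rpow_mul_intervalSpectrum_lt_top hlam (fun j => ?_) (fun j => ?_) <;>
        · rw [Pi.single_apply]
          split_ifs <;> linarith

lemma lintegral_norm_rpow_mul_spectrum_lt_top_of_neg (hd : 1 ≤ d) (hlam : ∀ j, 0 < lam j)
    (hs : -(d / 2 : ℝ) < s) (hs' : s < 0) :
    ∫⁻ x : EuclideanSpace ℝ (Fin d),
      ENNReal.ofReal (‖x‖ ^ (2 * s) * ∏ j, intervalSpectrum (lam j) (x j)) < ⊤ := by
  have hd0 : (0 : ℝ) < d := by exact_mod_cast hd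
  refine lt_of_le_of_lt (lintegral_mono_ae ?_)
    (lintegral_prod_rpow_mul_intervalSpectrum_lt_top (a := fun _ => 2 * s / d) hlam
      (fun _ => ?_) fun _ => ?_)
  · filter_upwards [ae_forall_coord_ne_zero d] with x hx
    refine ENNReal.ofReal_le_ofReal (mul_le_mul_of_nonneg_right ?_
      (Finset.prod_nonneg fun j _ => intervalSpectrum_nonneg _ _))
    calc ‖x‖ ^ (2 * s) = ∏ _j : Fin d, ‖x‖ ^ (2 * s / d) := by
          rw [Finset.prod_const, Finset.card_univ, Fintype.card_fin, ← Real.rpow_natCast,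
            ← Real.rpow_mul (norm_nonneg _), div_mul_cancel₀ _ hd0.ne']
      _ ≤ _ := by
          refine Finset.prod_le_prod (fun _ _ => by positivity) fun j _ => ?_
          exact Real.rpow_le_rpow_of_nonpos (abs_pos.2 (hx j)) (PiLp.norm_apply_le x j)
            (div_nonpos_of_nonpos_of_nonneg (by linarith) hd0.le)
  · rw [lt_div_iff₀ hd0]; linarith
  · exact (div_neg_of_neg_of_pos (by linarith) hd0).trans zero_lt_one

lemma lintegral_norm_rpow_mul_spectrum_eq_top_of_half_le (hd : 1 ≤ d) (hlam : ∀ j, 0 < lam j)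
    (hs : 1 / 2 ≤ s) :
    ∫⁻ x : EuclideanSpace ℝ (Fin d),
      ENNReal.ofReal (‖x‖ ^ (2 * s) * ∏ j, intervalSpectrum (lam j) (x j)) = ⊤ := by
  set i : Fin d := ⟨0, hd⟩
  have htop := lintegral_prod_rpow_mul_intervalSpectrum lam (Pi.single i (2 * s))
  rw [← Finset.mul_prod_erase _ _ (Finset.mem_univ i), Pi.single_eq_same,
    lintegral_abs_rpow_mul_intervalSpectrum_eq_top (hlam i) (by linarith), ENNReal.top_mul] at htop
  · rw [eq_top_iff, ← htop]
    refine lintegral_mono fun x => ENNReal.ofReal_le_ofReal (mul_le_mul_of_nonneg_right ?_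
      (Finset.prod_nonneg fun j _ => intervalSpectrum_nonneg _ _))
    rw [prod_abs_rpow_single]
    exact Real.rpow_le_rpow (abs_nonneg _) (PiLp.norm_apply_le x i) (by linarith)
  · refine Finset.prod_ne_zero_iff.2 fun j hj => ?_
    simpa [Pi.single_eq_of_ne (Finset.ne_of_mem_erase hj)] using
      lintegral_intervalSpectrum_ne_zero (hlam j)

lemma lintegral_norm_rpow_mul_spectrum_eq_top_of_le (hd : 1 ≤ d) (hlam : ∀ j, 0 < lam j)
    (hs : s ≤ -(d / 2 : ℝ)) :
    ∫⁻ x : EuclideanSpace ℝ (Fin d),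
      ENNReal.ofReal (‖x‖ ^ (2 * s) * ∏ j, intervalSpectrum (lam j) (x j)) = ⊤ := by
  have : Nonempty (Fin d) := ⟨⟨0, hd⟩⟩
  by_contra hfin
  set G : EuclideanSpace ℝ (Fin d) → ℝ := fun x => ∏ j, intervalSpectrum (lam j) (x j)
  have hGc : Continuous G := by fun_prop
  have hG0 : 0 < G 0 := Finset.prod_pos fun j _ => by
    simpa [intervalSpectrum] using pow_pos (hlam j) 2
  obtain ⟨r, hr, hball⟩ := Metric.eventually_nhds_iff_ball.1
    (hGc.continuousAt.eventually_const_lt (half_lt_self hG0))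
  have hInt : Integrable fun x : EuclideanSpace ℝ (Fin d) => ‖x‖ ^ (2 * s) * G x := by
    refine ⟨Measurable.aestronglyMeasurable (by fun_prop), ?_⟩
    rw [hasFiniteIntegral_iff_ofReal (.of_forall fun x => mul_nonneg (by positivity)
      (Finset.prod_nonneg fun j _ => intervalSpectrum_nonneg _ _))]
    exact lt_top_iff_ne_top.2 hfin
  have hBall : IntegrableOn (fun x : EuclideanSpace ℝ (Fin d) => ‖x‖ ^ (2 * s))
      (Metric.ball 0 r) := by
    refine Integrable.mono' (hInt.integrableOn.mul_const (G 0 / 2)⁻¹)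
      (Measurable.aestronglyMeasurable (by fun_prop)) ?_
    filter_upwards [self_mem_ae_restrict measurableSet_ball] with x hx
    rw [Real.norm_of_nonneg (by positivity), ← div_eq_mul_inv, le_div_iff₀ (by positivity)]
    exact mul_le_mul_of_nonneg_left (hball x hx).le (by positivity)
  rw [integrableOn_fun_norm_addHaar volume (f := fun y : ℝ => y ^ (2 * s)),
    finrank_euclideanSpace_fin] at hBall
  have hpow : IntegrableOn (fun y : ℝ => y ^ ((d : ℝ) - 1 + 2 * s)) (Set.Ioo 0 r) := by
    refine hBall.congr_fun (fun y hy => ?_) measurableSet_Ioo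
    simp only [smul_eq_mul]
    rw [Real.rpow_add hy.1, ← Nat.cast_pred hd, Real.rpow_natCast]
  rw [intervalIntegral.integrableOn_Ioo_rpow_iff hr] at hpow
  linarith

end

/-- The indicator function of a non-degenerate box
`Q = ∏_j [0, λ_j)` in `ℝ^d` belongs to the homogeneous fractional Sobolev space
`Ẇ^{s,2}(ℝ^d)` if and only if `−d/2 < s < 1/2`. -/
theorem indicator_box_mem_homogeneous_sobolev_iff
    (d : ℕ) (hd : 1 ≤ d) (lam : Fin d → ℝ) (hlam : ∀ j, 0 < lam j)
    (Q : Set (EuclideanSpace ℝ (Fin d)))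
    (hQ : Q = {x : EuclideanSpace ℝ (Fin d) | ∀ j, x j ∈ Set.Ico 0 (lam j)})
    (s : ℝ) :
    (∫⁻ x : EuclideanSpace ℝ (Fin d),
        ENNReal.ofReal
          (‖x‖ ^ (2 * s) * ‖𝓕 (Set.indicator Q fun _ => (1 : ℂ)) x‖ ^ 2)) < ⊤ ↔
      (-(d / 2 : ℝ) < s ∧ s < 1 / 2) := by
  change Q = euclideanBox lam at hQ
  subst hQ
  simp_rw [norm_sq_fourier_indicator_euclideanBox hlam]
  refine ⟨fun h => ⟨?_, ?_⟩, fun ⟨h₁, h₂⟩ => ?_⟩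
  · by_contra! hs
    exact h.ne (lintegral_norm_rpow_mul_spectrum_eq_top_of_le hd hlam hs)
  · by_contra! hs
    exact h.ne (lintegral_norm_rpow_mul_spectrum_eq_top_of_half_le hd hlam hs)
  · rcases le_or_gt 0 s with hs | hs
    · exact lintegral_norm_rpow_mul_spectrum_lt_top_of_nonneg hd hlam hs h₂
    · exact lintegral_norm_rpow_mul_spectrum_lt_top_of_neg hd hlam h₁ hs
end

section
/- Let d ∈ ℕ, d ≥ 1, p ≥ 1, and 0 < s < 1/p. Then there exists a finite constant C = C(s,d,p) > 0, independent of a and r, such that for every a ∈ ℝ^d, every r > 0, and every locally integrable function f : ℝ^d → ℝ, ∫_{ℝ^d} ∫_{ℝ^d} |(M_{a,r}f)(x) − (M_{a,r}f)(y)|^p / ‖x−y‖^{d+sp} dx dy ≤ C^p · ∫_{ℝ^d} ∫_{ℝ^d} |f(x) − f(y)|^p / ‖x−y‖^{d+sp} dx dy, where both sides are taken in [0,∞]. -/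
open MeasureTheory
open scoped ENNReal

/-- The cube-averaging operator `M_{a,r}`: at a point `x`, its value is the average of `f`
over the unique cube `Q_k^{a,r} = a + r(k + [0,1)^d)` of the partition that contains `x`
(so that `M_{a,r} f = ∑_{k∈ℤ^d} (r^{−d} ∫_{Q_k^{a,r}} f) 1_{Q_k^{a,r}}`). -/
noncomputable def cubeAvg {d : ℕ} (a : EuclideanSpace ℝ (Fin d)) (r : ℝ)
    (f : EuclideanSpace ℝ (Fin d) → ℝ) (x : EuclideanSpace ℝ (Fin d)) : ℝ :=
  (∫ y in {y : EuclideanSpace ℝ (Fin d) |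
      ∀ j, y j ∈ Set.Ico (a j + r * ⌊(x j - a j) / r⌋) (a j + r * (⌊(x j - a j) / r⌋ + 1))},
    f y) / r ^ d

/-- The cube `a + r (k + [0,1)^d)` of the mesh of size `r` anchored at `a`. -/
def meshCube {d : ℕ} (a : EuclideanSpace ℝ (Fin d)) (r : ℝ) (k : Fin d → ℤ) :
    Set (EuclideanSpace ℝ (Fin d)) :=
  {y | ∀ j, y j ∈ Set.Ico (a j + r * k j) (a j + r * (k j + 1))}

/-- The index of the mesh cube containing `x`. -/
noncomputable def meshIndex {d : ℕ} (a : EuclideanSpace ℝ (Fin d)) (r : ℝ)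
    (x : EuclideanSpace ℝ (Fin d)) : Fin d → ℤ :=
  fun j => ⌊(x j - a j) / r⌋

section Mesh

variable {d : ℕ} {a : EuclideanSpace ℝ (Fin d)} {r : ℝ}

lemma cubeAvg_eq_setIntegral_meshCube (f : EuclideanSpace ℝ (Fin d) → ℝ)
    (x : EuclideanSpace ℝ (Fin d)) :
    cubeAvg a r f x = (∫ y in meshCube a r (meshIndex a r x), f y) / r ^ d := rfl

lemma mem_meshCube_iff (hr : 0 < r) {k : Fin d → ℤ} {x : EuclideanSpace ℝ (Fin d)} :
    x ∈ meshCube a r k ↔ meshIndex a r x = k := by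
  simp only [meshCube, meshIndex, Set.mem_ofPred_eq, funext_iff, Set.mem_Ico, Int.floor_eq_iff,
    le_div_iff₀ hr, div_lt_iff₀ hr]
  refine forall_congr' fun j => and_congr ?_ ?_ <;> constructor <;> intro h <;> linarith

lemma measurable_meshIndex : Measurable (meshIndex a r) := by
  unfold meshIndex
  fun_prop

lemma measurableSet_meshCube (hr : 0 < r) (k : Fin d → ℤ) : MeasurableSet (meshCube a r k) := by
  have : meshCube a r k = meshIndex a r ⁻¹' {k} := by
    ext x
    simp [mem_meshCube_iff hr]
  rw [this]
  exact measurable_meshIndex (measurableSet_singleton k)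

lemma volume_setOf_forall_mem (T : Fin d → Set ℝ) :
    volume {x : EuclideanSpace ℝ (Fin d) | ∀ j, x j ∈ T j} = ∏ j, volume (T j) := by
  rw [← volume_pi_pi,
    ← (EuclideanSpace.volume_preserving_symm_measurableEquiv_toLp (Fin d)).measure_preimage_equiv]
  congr 1
  ext x
  simp

lemma volume_meshCube (hr : 0 < r) (k : Fin d → ℤ) :
    volume (meshCube a r k) = ENNReal.ofReal (r ^ d) := by
  rw [meshCube, volume_setOf_forall_mem, ENNReal.ofReal_pow hr.le]
  have (j : Fin d) : a j + r * (k j + 1) - (a j + r * k j) = r := by ring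
  simp [this]

lemma norm_sub_le_of_mem_meshCube (hr : 0 < r) {k : Fin d → ℤ} {x y : EuclideanSpace ℝ (Fin d)}
    (hx : x ∈ meshCube a r k) (hy : y ∈ meshCube a r k) : ‖x - y‖ ≤ d * r := by
  have h (j : Fin d) : ‖(x - y) j‖ ≤ r := by
    rw [Real.norm_eq_abs, PiLp.sub_apply, abs_le]
    obtain ⟨h1, h2⟩ := hx j
    obtain ⟨h3, h4⟩ := hy j
    constructor <;> linarith
  rw [EuclideanSpace.norm_eq]
  refine Real.sqrt_le_iff.2 ⟨by positivity, ?_⟩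
  calc ∑ j, ‖(x - y) j‖ ^ 2 ≤ ∑ _j : Fin d, r ^ 2 :=
        Finset.sum_le_sum fun j _ => pow_le_pow_left₀ (norm_nonneg _) (h j) 2
    _ = d * r ^ 2 := by simp
    _ ≤ (d * r) ^ 2 := by
        rw [mul_pow]
        gcongr
        exact_mod_cast Nat.le_self_pow two_ne_zero d

lemma volume_meshCube_inter_translate_le (hr : 0 < r) {k l : Fin d → ℤ} (hkl : k ≠ l)
    (z : EuclideanSpace ℝ (Fin d)) :
    volume {x | x ∈ meshCube a r k ∧ x + z ∈ meshCube a r l} ≤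
      ENNReal.ofReal (r ^ (d - 1) * ‖z‖) := by
  classical
  obtain ⟨i, hi⟩ := Function.ne_iff.1 hkl
  let b : ℝ := a i + r * max (k i) (l i)
  let T : Fin d → Set ℝ := fun j =>
    if j = i then Set.uIcc b (b - z i) else Set.Ico (a j + r * k j) (a j + r * (k j + 1))
  calc volume {x | x ∈ meshCube a r k ∧ x + z ∈ meshCube a r l}
      ≤ volume {x : EuclideanSpace ℝ (Fin d) | ∀ j, x j ∈ T j} := by
        refine measure_mono fun x ⟨hx, hxz⟩ j => ?_
        by_cases hj : j = i
        · subst hj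
          simp only [T, if_true, b]
          obtain ⟨h1, h2⟩ := hx j
          obtain ⟨h3, h4⟩ := hxz j
          rw [PiLp.add_apply] at h3 h4
          rw [Set.mem_uIcc]
          rcases lt_or_gt_of_ne hi with h | h
          · rw [max_eq_right (by exact_mod_cast h.le)]
            have : r * ((k j : ℝ) + 1) ≤ r * l j := by
              gcongr
              exact_mod_cast h
            right
            constructor <;> linarith
          · rw [max_eq_left (by exact_mod_cast h.le)]
            have : r * ((l j : ℝ) + 1) ≤ r * k j := by
              gcongr
              exact_mod_cast h
            left
            constructor <;> linarith
        · simpa [T, hj] using hx j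
    _ = ENNReal.ofReal (r ^ (d - 1) * |z i|) := by
        rw [volume_setOf_forall_mem, ← Finset.mul_prod_erase _ _ (Finset.mem_univ i),
          mul_comm, ENNReal.ofReal_mul (by positivity), ENNReal.ofReal_pow hr.le]
        congr 1
        · rw [Finset.prod_congr rfl (g := fun _ => ENNReal.ofReal r)]
          · simp
          · intro j hj
            have : a j + r * (k j + 1) - (a j + r * k j) = r := by ring
            simp [T, Finset.ne_of_mem_erase hj, this]
        · simp [T]
    _ ≤ _ := by
        gcongr
        exact PiLp.norm_apply_le z i

end Mesh

lemma exists_setLIntegral_ball_norm_rpow_le {d : ℕ} (hd : 1 ≤ d) {β : ℝ} (hβ : β < d) :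
    ∃ B : ℝ, 0 ≤ B ∧ ∀ R : ℝ, 0 < R →
      ∫⁻ z in Metric.ball (0 : EuclideanSpace ℝ (Fin d)) R, ENNReal.ofReal (‖z‖ ^ (-β)) ≤
        ENNReal.ofReal (B * R ^ (d - β)) := by
  have hInt (R : ℝ) : IntegrableOn (fun z : EuclideanSpace ℝ (Fin d) => ‖z‖ ^ (-β))
      (Metric.ball 0 R) volume := by
    refine integrableOn_ball_of_norm_le_rpow (C := 1) (α := β) (by simpa using hd)
      (by simpa using hβ) (Filter.Eventually.of_forall fun z => ?_) ?_
    · rw [Real.norm_of_nonneg (by positivity), one_mul]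
    · exact (by fun_prop : Measurable _).aestronglyMeasurable
  refine ⟨∫ z in Metric.ball (0 : EuclideanSpace ℝ (Fin d)) 1, ‖z‖ ^ (-β),
    integral_nonneg fun z => by positivity, fun R hR => ?_⟩
  rw [← ofReal_integral_eq_lintegral_ofReal (hInt R)
    (Filter.Eventually.of_forall fun z => by positivity)]
  refine ENNReal.ofReal_le_ofReal (le_of_eq ?_)
  have h := Measure.setIntegral_comp_smul_of_pos volume
    (fun z : EuclideanSpace ℝ (Fin d) => ‖z‖ ^ (-β)) (Metric.ball 0 1) hR
  have hn (z : EuclideanSpace ℝ (Fin d)) : ‖R • z‖ ^ (-β) = R ^ (-β) * ‖z‖ ^ (-β) := by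
    rw [norm_smul, Real.norm_of_nonneg hR.le, Real.mul_rpow hR.le (norm_nonneg z)]
  simp only [hn, integral_const_mul, smul_unitBall_of_pos hR, smul_eq_mul,
    finrank_euclideanSpace, Fintype.card_fin] at h
  rw [sub_eq_add_neg, Real.rpow_add hR, Real.rpow_natCast]
  field_simp at h
  linarith

lemma setLIntegral_meshCube_prod_le {d : ℕ} {a : EuclideanSpace ℝ (Fin d)} {r : ℝ} (hr : 0 < r)
    {k l : Fin d → ℤ} (hkl : k ≠ l) (α : ℝ) {R : ℝ}
    (hR : ∀ x ∈ meshCube a r k, ∀ y ∈ meshCube a r l, ‖x - y‖ < R) :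
    ∫⁻ w in meshCube a r k ×ˢ meshCube a r l, ENNReal.ofReal (‖w.1 - w.2‖ ^ (-α)) ≤
      ENNReal.ofReal (r ^ (d - 1)) *
        ∫⁻ z in Metric.ball (0 : EuclideanSpace ℝ (Fin d)) R,
          ENNReal.ofReal (‖z‖ ^ (-(α - 1))) := by
  have hk := measurableSet_meshCube (a := a) hr k
  have hl := measurableSet_meshCube (a := a) hr l
  have hF : Measurable ((meshCube a r k ×ˢ meshCube a r l).indicator
      fun w => ENNReal.ofReal (‖w.1 - w.2‖ ^ (-α))) :=
    Measurable.indicator (by fun_prop) (hk.prod hl)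
  have hS (z : EuclideanSpace ℝ (Fin d)) :
      MeasurableSet {x | x ∈ meshCube a r k ∧ x + z ∈ meshCube a r l} :=
    hk.inter ((measurable_add_const z) hl)
  rw [← lintegral_indicator (hk.prod hl), ← lintegral_const_mul _ (by fun_prop),
    ← lintegral_indicator Metric.isOpen_ball.measurableSet, Measure.volume_eq_prod,
    ← (measurePreserving_prod_add volume volume).lintegral_comp hF, 
    lintegral_prod_symm' _ (by exact hF.comp (measurePreserving_prod_add volume volume).measurable)]
  refine lintegral_mono fun z => ?_
  by_cases hz : ‖z‖ < R
  · rw [Set.indicator_of_mem (by simpa using hz)]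
    calc _ = ∫⁻ x, {x | x ∈ meshCube a r k ∧ x + z ∈ meshCube a r l}.indicator
          (fun _ => ENNReal.ofReal (‖z‖ ^ (-α))) x := by
          refine lintegral_congr fun x => ?_
          by_cases h : x ∈ {x | x ∈ meshCube a r k ∧ x + z ∈ meshCube a r l}
          · refine (Set.indicator_of_mem (Set.mk_mem_prod h.1 h.2) _).trans ?_
            rw [Set.indicator_of_mem h]
            simp
          · refine (Set.indicator_of_notMem (fun h' => h ⟨h'.1, h'.2⟩) _).trans ?_
            rw [Set.indicator_of_notMem h]
      _ = ENNReal.ofReal (‖z‖ ^ (-α)) *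
          volume {x | x ∈ meshCube a r k ∧ x + z ∈ meshCube a r l} :=
          lintegral_indicator_const (hS z) _
      _ ≤ ENNReal.ofReal (‖z‖ ^ (-α)) * ENNReal.ofReal (r ^ (d - 1) * ‖z‖) := by
          gcongr
          exact volume_meshCube_inter_translate_le hr hkl z
      _ ≤ _ := by
          rw [← ENNReal.ofReal_mul (by positivity), ← ENNReal.ofReal_mul (by positivity)]
          refine ENNReal.ofReal_le_ofReal ?_
          rcases (norm_nonneg z).eq_or_lt with h0 | h0
          · simp only [← h0, mul_zero]
            positivity
          · rw [neg_sub, sub_eq_add_neg, Real.rpow_add h0, Real.rpow_one]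
            exact le_of_eq (by ring)
  · rw [lintegral_eq_zero_of_ae_eq_zero]
    · exact zero_le
    · refine Filter.Eventually.of_forall fun x => Set.indicator_of_notMem (fun h => hz ?_) _
      simpa using hR _ h.1 _ h.2

lemma exists_setLIntegral_meshCube_prod_le {d : ℕ} (hd : 1 ≤ d) {α : ℝ} (hα : 0 < α)
    (hαd : α < d + 1) :
    ∃ K : ℝ, 0 < K ∧ ∀ (a : EuclideanSpace ℝ (Fin d)) (r : ℝ), 0 < r → ∀ k l : Fin d → ℤ, k ≠ l →
      ∀ u ∈ meshCube a r k, ∀ v ∈ meshCube a r l,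
        ∫⁻ w in meshCube a r k ×ˢ meshCube a r l, ENNReal.ofReal (‖w.1 - w.2‖ ^ (-α)) ≤
          ENNReal.ofReal (K * (r ^ d * r ^ d) * ‖u - v‖ ^ (-α)) := by
  obtain ⟨B, hB, hBR⟩ := exists_setLIntegral_ball_norm_rpow_le hd (β := α - 1) (by linarith)
  have hd0 : (0 : ℝ) < d := by exact_mod_cast hd
  refine ⟨2 ^ α + B * (6 * d) ^ (d + 1), by positivity, fun a r hr k l hkl u hu v hv => ?_⟩
  have huv : u ≠ v := fun h => hkl <| by
    rw [← (mem_meshCube_iff hr).1 hu, ← (mem_meshCube_iff hr).1 hv, h]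
  have hD : 0 < ‖u - v‖ := norm_sub_pos_iff.2 huv
  have hr' : 0 < d * r := by positivity
  have htri (x : EuclideanSpace ℝ (Fin d)) (hx : x ∈ meshCube a r k)
      (y : EuclideanSpace ℝ (Fin d)) (hy : y ∈ meshCube a r l) :
      ‖x - y‖ ≤ ‖u - v‖ + 2 * (d * r) ∧ ‖u - v‖ ≤ ‖x - y‖ + 2 * (d * r) := by
    have h1 := norm_sub_le_of_mem_meshCube hr hx hu
    have h2 := norm_sub_le_of_mem_meshCube hr hy hv
    have h3 : ‖(x - y) - (u - v)‖ ≤ ‖x - u‖ + ‖y - v‖ := by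
      rw [show (x - y) - (u - v) = (x - u) - (y - v) by abel]
      exact norm_sub_le _ _
    have h4 := abs_le.1 ((abs_norm_sub_norm_le (x - y) (u - v)).trans h3)
    constructor <;> linarith [h4.1, h4.2]
  rcases le_or_gt (4 * (d * r)) ‖u - v‖ with hfar | hnear
  · calc ∫⁻ w in meshCube a r k ×ˢ meshCube a r l, ENNReal.ofReal (‖w.1 - w.2‖ ^ (-α))
        ≤ ∫⁻ w in meshCube a r k ×ˢ meshCube a r l, ENNReal.ofReal ((‖u - v‖ / 2) ^ (-α)) := by
          refine setLIntegral_mono (by fun_prop) fun w hw => ENNReal.ofReal_le_ofReal ?_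
          refine Real.rpow_le_rpow_of_nonpos (by positivity) ?_ (by linarith)
          linarith [(htri _ hw.1 _ hw.2).2]
      _ = ENNReal.ofReal ((2 ^ α) * (r ^ d * r ^ d) * ‖u - v‖ ^ (-α)) := by
          rw [setLIntegral_const, Measure.volume_eq_prod, Measure.prod_prod, volume_meshCube hr,
            volume_meshCube hr, ← ENNReal.ofReal_mul (by positivity),
            ← ENNReal.ofReal_mul (by positivity), Real.div_rpow hD.le zero_le_two,
            Real.rpow_neg zero_le_two]
          congr 1
          field_simp
      _ ≤ _ := by
          gcongr
          exact le_add_of_nonneg_right (by positivity)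
  · calc ∫⁻ w in meshCube a r k ×ˢ meshCube a r l, ENNReal.ofReal (‖w.1 - w.2‖ ^ (-α))
        ≤ ENNReal.ofReal (r ^ (d - 1)) * ENNReal.ofReal (B * (6 * (d * r)) ^ (d - (α - 1))) :=
          (setLIntegral_meshCube_prod_le (R := 6 * (d * r)) hr hkl α fun x hx y hy => by
            linarith [(htri x hx y hy).1]).trans (by gcongr; exact hBR _ (by positivity))
      _ = ENNReal.ofReal (B * (6 * d) ^ (d + 1) * (r ^ d * r ^ d) * (6 * (d * r)) ^ (-α)) := by
          rw [← ENNReal.ofReal_mul (by positivity),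
            show (d : ℝ) - (α - 1) = ((d + 1 : ℕ) : ℝ) + (-α) by push_cast; ring,
            Real.rpow_add (by positivity), Real.rpow_natCast, ← mul_assoc 6, mul_pow _ r,
            ← pow_sub_one_mul (n := d) (by lia) r, pow_succ r d,
            ← pow_sub_one_mul (n := d) (by lia) r]
          congr 1
          ring
      _ ≤ _ := by
          refine ENNReal.ofReal_le_ofReal ?_
          gcongr ?_ * _ * ?_
          · exact le_add_of_nonneg_left (by positivity)
          · exact Real.rpow_le_rpow_of_nonpos hD (by linarith) (by linarith)

lemma ofReal_abs_integral_sub_integral_rpow_le {X Y : Type*} [MeasurableSpace X]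
    [MeasurableSpace Y] (μ : Measure X) (ν : Measure Y) [IsProbabilityMeasure μ]
    [IsProbabilityMeasure ν] {f : X → ℝ} {g : Y → ℝ} (hf : Integrable f μ) (hg : Integrable g ν)
    {p : ℝ} (hp : 1 ≤ p) :
    ENNReal.ofReal (|∫ x, f x ∂μ - ∫ y, g y ∂ν| ^ p) ≤
      ∫⁻ w, ENNReal.ofReal (|f w.1 - g w.2| ^ p) ∂(μ.prod ν) := by
  have hp0 : 0 < p := by linarith
  have hfg := (hf.comp_fst ν).sub (hg.comp_snd μ)
  have hInt : ∫ x, f x ∂μ - ∫ y, g y ∂ν = ∫ w, (f w.1 - g w.2) ∂(μ.prod ν) := by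
    rw [integral_sub (hf.comp_fst ν) (hg.comp_snd μ), integral_fun_fst, integral_fun_snd]
    simp
  have hpow (x : ℝ) : ENNReal.ofReal (|x| ^ p) = ‖x‖ₑ ^ p := by
    rw [← ENNReal.ofReal_rpow_of_nonneg (abs_nonneg x) hp0.le, ← Real.enorm_eq_ofReal_abs]
  simp_rw [hpow]
  rw [hInt, ← ENNReal.le_rpow_inv_iff hp0]
  calc ‖∫ w, (f w.1 - g w.2) ∂(μ.prod ν)‖ₑ
      ≤ ∫⁻ w, ‖f w.1 - g w.2‖ₑ ∂(μ.prod ν) := enorm_integral_le_lintegral_enorm _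
    _ = eLpNorm' (fun w => f w.1 - g w.2) 1 (μ.prod ν) := by simp [eLpNorm']
    _ ≤ eLpNorm' (fun w => f w.1 - g w.2) p (μ.prod ν) :=
        eLpNorm'_le_eLpNorm'_of_exponent_le zero_lt_one hp _ hfg.aestronglyMeasurable
    _ = _ := by simp [eLpNorm']

lemma MeasureTheory.LocallyIntegrable.integrableOn_meshCube {d : ℕ}
    {f : EuclideanSpace ℝ (Fin d) → ℝ} (hf : LocallyIntegrable f volume)
    (a : EuclideanSpace ℝ (Fin d)) {r : ℝ} (hr : 0 < r) (k : Fin d → ℤ) :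
    IntegrableOn f (meshCube a r k) volume := by
  rcases (meshCube a r k).eq_empty_or_nonempty with h | ⟨u, hu⟩
  · simp [h]
  · refine (hf.integrableOn_isCompact (isCompact_closedBall u (d * r))).mono_set fun x hx => ?_
    rw [mem_closedBall_iff_norm]
    exact norm_sub_le_of_mem_meshCube hr hx hu

lemma ofReal_abs_meshCube_average_sub_rpow_le {d : ℕ} {f : EuclideanSpace ℝ (Fin d) → ℝ}
    (hf : LocallyIntegrable f volume) (a : EuclideanSpace ℝ (Fin d)) {r : ℝ} (hr : 0 < r)
    (k l : Fin d → ℤ) {p : ℝ} (hp : 1 ≤ p) :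
    ENNReal.ofReal
        (|(∫ y in meshCube a r k, f y) / r ^ d - (∫ y in meshCube a r l, f y) / r ^ d| ^ p) ≤
      ENNReal.ofReal (r ^ d * r ^ d)⁻¹ *
        ∫⁻ w in meshCube a r k ×ˢ meshCube a r l, ENNReal.ofReal (|f w.1 - f w.2| ^ p) := by
  have hrd : 0 < r ^ d := by positivity
  set c : ℝ≥0∞ := ENNReal.ofReal (r ^ d)⁻¹
  have hprob (m : Fin d → ℤ) : IsProbabilityMeasure (c • volume.restrict (meshCube a r m)) := by
    refine ⟨?_⟩
    rw [Measure.smul_apply, Measure.restrict_apply_univ, volume_meshCube hr, smul_eq_mul,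
      ← ENNReal.ofReal_mul (by positivity), inv_mul_cancel₀ hrd.ne', ENNReal.ofReal_one]
  have hInt (m : Fin d → ℤ) : Integrable f (c • volume.restrict (meshCube a r m)) :=
    (hf.integrableOn_meshCube a hr m).smul_measure ENNReal.ofReal_ne_top
  have hval (m : Fin d → ℤ) : ∫ x, f x ∂(c • volume.restrict (meshCube a r m)) =
      (∫ x in meshCube a r m, f x) / r ^ d := by
    rw [integral_smul_measure, ENNReal.toReal_ofReal (by positivity), smul_eq_mul, div_eq_inv_mul]
  have := ofReal_abs_integral_sub_integral_rpow_le _ _ (hInt k) (hInt l) hp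
  rwa [hval, hval, Measure.prod_smul_left, Measure.prod_smul_right, Measure.prod_restrict,
    lintegral_smul_measure, lintegral_smul_measure, smul_eq_mul, smul_eq_mul, ← mul_assoc,
    ← ENNReal.ofReal_mul (by positivity), ← mul_inv] at this

lemma setLIntegral_meshCube_prod_gagliardo_le {d : ℕ} {α p K : ℝ} (hp : 1 ≤ p)
    (hK : 0 ≤ K) {f : EuclideanSpace ℝ (Fin d) → ℝ}
    (hf : LocallyIntegrable f volume) {a : EuclideanSpace ℝ (Fin d)} {r : ℝ} (hr : 0 < r)
    {k l : Fin d → ℤ}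
    (hkl : ∀ u ∈ meshCube a r k, ∀ v ∈ meshCube a r l,
      ∫⁻ w in meshCube a r k ×ˢ meshCube a r l, ENNReal.ofReal (‖w.1 - w.2‖ ^ (-α)) ≤
        ENNReal.ofReal (K * (r ^ d * r ^ d) * ‖u - v‖ ^ (-α))) :
    ∫⁻ w in meshCube a r k ×ˢ meshCube a r l,
        ENNReal.ofReal (|cubeAvg a r f w.1 - cubeAvg a r f w.2| ^ p / ‖w.1 - w.2‖ ^ α) ≤
      ENNReal.ofReal K * ∫⁻ w in meshCube a r k ×ˢ meshCube a r l,
        ENNReal.ofReal (|f w.1 - f w.2| ^ p / ‖w.1 - w.2‖ ^ α) := by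
  have hS := (measurableSet_meshCube (a := a) hr k).prod (measurableSet_meshCube (a := a) hr l)
  have hrr : 0 < r ^ d * r ^ d := by positivity
  set I := ∫⁻ w in meshCube a r k ×ˢ meshCube a r l, ENNReal.ofReal (‖w.1 - w.2‖ ^ (-α)) with hI
  set A := |(∫ y in meshCube a r k, f y) / r ^ d - (∫ y in meshCube a r l, f y) / r ^ d| ^ p
  calc ∫⁻ w in meshCube a r k ×ˢ meshCube a r l,
        ENNReal.ofReal (|cubeAvg a r f w.1 - cubeAvg a r f w.2| ^ p / ‖w.1 - w.2‖ ^ α)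
      = ENNReal.ofReal A * I := by
        rw [hI, ← lintegral_const_mul _ (by fun_prop)]
        refine setLIntegral_congr_fun hS fun w hw => ?_
        simp only [cubeAvg_eq_setIntegral_meshCube, (mem_meshCube_iff hr).1 hw.1,
          (mem_meshCube_iff hr).1 hw.2]
        rw [← ENNReal.ofReal_mul (by positivity), Real.rpow_neg (norm_nonneg _), div_eq_mul_inv]
    _ ≤ ENNReal.ofReal (r ^ d * r ^ d)⁻¹ * (∫⁻ w in meshCube a r k ×ˢ meshCube a r l,
          ENNReal.ofReal (|f w.1 - f w.2| ^ p)) * I := by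
        gcongr
        exact ofReal_abs_meshCube_average_sub_rpow_le hf a hr k l hp
    _ ≤ ENNReal.ofReal (r ^ d * r ^ d)⁻¹ * ∫⁻ w in meshCube a r k ×ˢ meshCube a r l,
          ENNReal.ofReal (|f w.1 - f w.2| ^ p) * I := by
        rw [mul_assoc]
        gcongr
        exact lintegral_mul_const_le _ _
    _ ≤ ENNReal.ofReal (r ^ d * r ^ d)⁻¹ * ∫⁻ w in meshCube a r k ×ˢ meshCube a r l,
          ENNReal.ofReal (K * (r ^ d * r ^ d)) *
            ENNReal.ofReal (|f w.1 - f w.2| ^ p / ‖w.1 - w.2‖ ^ α) := by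
        refine mul_le_mul_right (setLIntegral_mono' hS fun w hw => ?_) _
        refine (mul_le_mul_right (hkl _ hw.1 _ hw.2) _).trans_eq ?_
        rw [← ENNReal.ofReal_mul (by positivity), ← ENNReal.ofReal_mul (by positivity),
          Real.rpow_neg (norm_nonneg _)]
        congr 1
        ring
    _ = _ := by
        rw [lintegral_const_mul' _ _ ENNReal.ofReal_ne_top, ← mul_assoc,
          ← ENNReal.ofReal_mul (by positivity)]
        congr 2
        field_simp

lemma lintegral_prod_eq_tsum_meshCube {d : ℕ} (a : EuclideanSpace ℝ (Fin d)) {r : ℝ} (hr : 0 < r)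
    {F : EuclideanSpace ℝ (Fin d) × EuclideanSpace ℝ (Fin d) → ℝ≥0∞}
    (hF : AEMeasurable F volume) :
    ∫⁻ x, ∫⁻ y, F (x, y) = ∑' m : (Fin d → ℤ) × (Fin d → ℤ),
      ∫⁻ w in meshCube a r m.1 ×ˢ meshCube a r m.2, F w := by
  have hU : (⋃ m : (Fin d → ℤ) × (Fin d → ℤ), meshCube a r m.1 ×ˢ meshCube a r m.2) =
      Set.univ := by
    refine Set.eq_univ_of_forall fun w => Set.mem_iUnion.2 ⟨(meshIndex a r w.1, meshIndex a r w.2),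
      (mem_meshCube_iff hr).2 rfl, (mem_meshCube_iff hr).2 rfl⟩
  rw [← lintegral_prod _ hF, ← lintegral_iUnion, hU, Measure.restrict_univ, Measure.volume_eq_prod]
  · exact fun m => (measurableSet_meshCube hr m.1).prod (measurableSet_meshCube hr m.2)
  · intro m n hmn
    refine Set.disjoint_left.2 fun w hm hn => hmn (Prod.ext ?_ ?_)
    · rw [← (mem_meshCube_iff hr).1 hm.1, (mem_meshCube_iff hr).1 hn.1]
    · rw [← (mem_meshCube_iff hr).1 hm.2, (mem_meshCube_iff hr).1 hn.2]

lemma measurable_cubeAvg {d : ℕ} (a : EuclideanSpace ℝ (Fin d)) (r : ℝ)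
    (f : EuclideanSpace ℝ (Fin d) → ℝ) : Measurable (cubeAvg a r f) :=
  (measurable_of_countable (fun k : Fin d → ℤ => (∫ y in meshCube a r k, f y) / r ^ d)).comp
    measurable_meshIndex

lemma aemeasurable_gagliardo_integrand {d : ℕ} {g : EuclideanSpace ℝ (Fin d) → ℝ}
    (hg : AEMeasurable g volume) (p α : ℝ) :
    AEMeasurable (fun w : EuclideanSpace ℝ (Fin d) × EuclideanSpace ℝ (Fin d) =>
      ENNReal.ofReal (|g w.1 - g w.2| ^ p / ‖w.1 - w.2‖ ^ α)) volume := by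
  have h1 : AEMeasurable (fun w : EuclideanSpace ℝ (Fin d) × EuclideanSpace ℝ (Fin d) => g w.1)
      volume := hg.comp_fst
  have h2 : AEMeasurable (fun w : EuclideanSpace ℝ (Fin d) × EuclideanSpace ℝ (Fin d) => g w.2)
      volume := hg.comp_snd
  exact (((h1.sub h2).norm.pow_const p).div (by fun_prop)).ennreal_ofReal

/-- The cube-averaging operators are bounded on the Gagliardo seminorm of
order `s`, `0 < s < 1/p`, uniformly in the anchor point `a` and the mesh `r`. -/
theorem cubeAvg_gagliardo_bound
    (d : ℕ) (hd : 1 ≤ d) (p : ℝ) (hp : 1 ≤ p) (s : ℝ) (hs : 0 < s) (hsp : s < 1 / p) :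
    ∃ C : ℝ, 0 < C ∧
      ∀ (a : EuclideanSpace ℝ (Fin d)) (r : ℝ), 0 < r →
        ∀ f : EuclideanSpace ℝ (Fin d) → ℝ, LocallyIntegrable f volume →
          (∫⁻ x : EuclideanSpace ℝ (Fin d), ∫⁻ y : EuclideanSpace ℝ (Fin d),
              ENNReal.ofReal
                (|cubeAvg a r f x - cubeAvg a r f y| ^ p / ‖x - y‖ ^ ((d : ℝ) + s * p))) ≤
            ENNReal.ofReal (C ^ p) *
              ∫⁻ x : EuclideanSpace ℝ (Fin d), ∫⁻ y : EuclideanSpace ℝ (Fin d),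
                ENNReal.ofReal (|f x - f y| ^ p / ‖x - y‖ ^ ((d : ℝ) + s * p)) := by
  have hp0 : 0 < p := by linarith
  have hsp' : s * p < 1 := (lt_div_iff₀ hp0).1 hsp
  obtain ⟨K, hK, hKr⟩ := exists_setLIntegral_meshCube_prod_le hd
    (α := d + s * p) (by positivity) (by linarith)
  refine ⟨K ^ p⁻¹, by positivity, fun a r hr f hf => ?_⟩
  rw [Real.rpow_inv_rpow hK.le hp0.ne',
    lintegral_prod_eq_tsum_meshCube a hr
      (aemeasurable_gagliardo_integrand (measurable_cubeAvg a r f).aemeasurable p (d + s * p)),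
    lintegral_prod_eq_tsum_meshCube a hr
      (aemeasurable_gagliardo_integrand hf.aestronglyMeasurable.aemeasurable p (d + s * p)),
    ← ENNReal.tsum_mul_left]
  refine ENNReal.tsum_le_tsum fun ⟨k, l⟩ => ?_
  by_cases hkl : k = l
  · subst hkl
    refine (setLIntegral_congr_fun (g := fun _ => 0) ((measurableSet_meshCube hr k).prod
      (measurableSet_meshCube hr k)) fun w hw => ?_).trans_le (by simp)
    simp [cubeAvg_eq_setIntegral_meshCube, (mem_meshCube_iff hr).1 hw.1,
      (mem_meshCube_iff hr).1 hw.2, Real.zero_rpow hp0.ne']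
  · exact setLIntegral_meshCube_prod_gagliardo_le hp hK.le hf hr (hKr a r hr k l hkl)
end
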